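/- arXiv:1701.00360 — 7 statements merged into one kernel-verified Lean document; each statement's English description precedes it below -/
import Mathlib

section
/- A real-valued random variable W has the standard normal distribution N(0,1) if and only if E[f'(W) − W·f(W)] = 0 for every continuously differentiable function f: ℝ → ℝ such that both f and f' are bounded. -/
open MeasureTheory ProbabilityTheory

lemma hasDerivAt_gaussianPDFReal_zero_one (x : ℝ) :
    HasDerivAt (gaussianPDFReal 0 1) (-x * gaussianPDFReal 0 1 x) x := by
  have h : HasDerivAt (fun y : ℝ ↦ -(y - 0) ^ 2 / (2 * ((1 : NNReal) : ℝ))) (-x) x := by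
    have := ((((hasDerivAt_id x).sub_const 0).pow 2).neg).div_const (2 * ((1 : NNReal) : ℝ))
    convert! this using 1
    simp
    ring
  rw [gaussianPDFReal_def]
  convert! h.exp.const_mul (√(2 * Real.pi * ((1 : NNReal) : ℝ)))⁻¹ using 1
  ring

lemma continuous_gaussianPDFReal_zero_one : Continuous (gaussianPDFReal 0 1) :=
  continuous_iff_continuousAt.2 fun x ↦ (hasDerivAt_gaussianPDFReal_zero_one x).continuousAt

lemma integrable_id_mul_gaussianPDFReal_zero_one :
    Integrable fun x ↦ x * gaussianPDFReal 0 1 x := by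
  have h := (integrable_mul_exp_neg_mul_sq (b := 1 / 2) (by norm_num)).const_mul
    (√(2 * Real.pi * ((1 : NNReal) : ℝ)))⁻¹
  convert! h using 2 with x
  rw [gaussianPDFReal]
  have : -(x - 0) ^ 2 / (2 * ((1 : NNReal) : ℝ)) = -(1 / 2) * x ^ 2 := by
    push_cast
    ring
  rw [this]
  ring

/-- Gaussian integration by parts for bounded `C¹` functions with bounded derivative. -/
lemma integral_deriv_sub_id_mul_gaussianReal {f : ℝ → ℝ} (hf : ContDiff ℝ 1 f)
    (hb : ∃ C, ∀ x, |f x| ≤ C) (hb' : ∃ C, ∀ x, |deriv f x| ≤ C) :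
    ∫ x, (deriv f x - x * f x) ∂gaussianReal 0 1 = 0 := by
  obtain ⟨C, hC⟩ := hb
  obtain ⟨C', hC'⟩ := hb'
  have hcf : Continuous f := hf.continuous
  have hcf' : Continuous (deriv f) := hf.continuous_deriv le_rfl
  have h₀ : Integrable fun x ↦ f x * gaussianPDFReal 0 1 x :=
    (integrable_gaussianPDFReal 0 1).bdd_mul hcf.aestronglyMeasurable (ae_of_all _ hC)
  have h₁ : Integrable fun x ↦ deriv f x * gaussianPDFReal 0 1 x :=
    (integrable_gaussianPDFReal 0 1).bdd_mul hcf'.aestronglyMeasurable (ae_of_all _ hC')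
  have h₂ : Integrable fun x ↦ f x * (x * gaussianPDFReal 0 1 x) :=
    integrable_id_mul_gaussianPDFReal_zero_one.bdd_mul hcf.aestronglyMeasurable (ae_of_all _ hC)
  rw [integral_gaussianReal_eq_integral_smul one_ne_zero]
  refine integral_eq_zero_of_hasDerivAt_of_integrable
    (f := fun x ↦ f x * gaussianPDFReal 0 1 x) (fun x ↦ ?_) ?_ h₀
  · convert! ((hf.differentiable one_ne_zero x).hasDerivAt.mul
      (hasDerivAt_gaussianPDFReal_zero_one x)) using 1
    simp only [smul_eq_mul]
    ring
  · convert! h₁.sub h₂ using 2 with x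
    simp only [smul_eq_mul, Pi.sub_apply]
    ring

/-- Stein's equation `f' - x f = g` has a compactly supported solution when `g` is continuous,
compactly supported and centered for the Gaussian measure. -/
lemma exists_hasCompactSupport_stein_equation {g : ℝ → ℝ} (hg : Continuous g)
    (hgs : HasCompactSupport g) (hg0 : ∫ x, g x ∂gaussianReal 0 1 = 0) :
    ∃ f : ℝ → ℝ, ContDiff ℝ 1 f ∧ HasCompactSupport f ∧ ∀ x, deriv f x - x * f x = g x := by
  set φ := gaussianPDFReal 0 1 with hφ
  have hφc : Continuous φ := continuous_gaussianPDFReal_zero_one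
  have hφ0 (x : ℝ) : φ x ≠ 0 := (gaussianPDFReal_pos 0 1 x one_ne_zero).ne'
  obtain ⟨R, hR⟩ := hgs.isCompact.isBounded.subset_ball 0
  have hzero (x : ℝ) (hx : R ≤ |x|) : g x = 0 := by
    by_contra h
    have := hR (subset_tsupport g h)
    rw [Metric.mem_ball, dist_zero_right, Real.norm_eq_abs] at this
    linarith
  have hc : Continuous fun x ↦ φ x * g x := hφc.mul hg
  let F : ℝ → ℝ := fun x ↦ ∫ t in (-R)..x, φ t * g t
  have hF (x : ℝ) : HasDerivAt F (φ x * g x) x :=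
    intervalIntegral.integral_hasDerivAt_right (hc.intervalIntegrable _ _)
      (hc.stronglyMeasurableAtFilter _ _) hc.continuousAt
  have hder (x : ℝ) : HasDerivAt (fun y ↦ F y / φ y) (g x + x * (F x / φ x)) x := by
    convert! (hF x).div (hasDerivAt_gaussianPDFReal_zero_one x) (hφ0 x) using 1
    rw [← hφ]
    field_simp [hφ0 x]
    ring
  have hcont : Continuous fun y ↦ F y / φ y :=
    continuous_iff_continuousAt.2 fun x ↦ (hder x).continuousAt
  refine ⟨fun y ↦ F y / φ y, ?_, ?_, fun x ↦ ?_⟩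
  · rw [contDiff_one_iff_deriv]
    refine ⟨fun x ↦ (hder x).differentiableAt, ?_⟩
    rw [show deriv (fun y ↦ F y / φ y) = fun x ↦ g x + x * (F x / φ x) from
      funext fun x ↦ (hder x).deriv]
    fun_prop
  · refine HasCompactSupport.intro (isCompact_Icc (a := -R) (b := R)) fun x hx ↦ ?_
    suffices F x = 0 by simp [this]
    rcases lt_or_ge x (-R) with h | h
    · refine (intervalIntegral.integral_congr (g := fun _ ↦ (0 : ℝ)) fun t ht ↦ ?_).trans
        intervalIntegral.integral_zero
      rw [Set.uIcc_of_ge h.le] at ht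
      simp only [hzero t (by linarith [neg_le_abs t, ht.2]), mul_zero]
    · have hx' : R < x := by
        by_contra! h'
        exact hx ⟨h, h'⟩
      rw [integral_gaussianReal_eq_integral_smul one_ne_zero] at hg0
      refine (intervalIntegral.integral_eq_integral_of_support_subset fun t ht ↦ ?_).trans hg0
      have hlt : |t| < R := by
        by_contra! h'
        exact ht (by simp only [hzero t h', mul_zero])
      exact ⟨(abs_lt.1 hlt).1, ((abs_lt.1 hlt).2.trans hx').le⟩
  · rw [(hder x).deriv]
    ring

/-- A probability measure that integrates to zero every continuous compactly supported function
centered for `ν` is equal to `ν`. -/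
lemma eq_of_forall_hasCompactSupport_integral_eq_zero {μ ν : Measure ℝ} [IsProbabilityMeasure μ]
    [IsProbabilityMeasure ν] [ν.IsOpenPosMeasure]
    (h : ∀ g : ℝ → ℝ, Continuous g → HasCompactSupport g → ∫ x, g x ∂ν = 0 → ∫ x, g x ∂μ = 0) :
    μ = ν := by
  obtain ⟨k, hks, hk0, hk⟩ := exists_continuous_nonneg_pos (0 : ℝ)
  have hpos : 0 < ∫ x, k x ∂ν :=
    k.continuous.integral_pos_of_hasCompactSupport_nonneg_nonzero hks hk0 hk
  have hki (ρ : Measure ℝ) [IsProbabilityMeasure ρ] : Integrable k ρ :=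
    k.continuous.integrable_of_hasCompactSupport hks
  let r : NNReal := ⟨(∫ x, k x ∂μ) / ∫ x, k x ∂ν,
    div_nonneg (integral_nonneg hk0) hpos.le⟩
  have hμ : μ = r • ν := by
    refine Measure.ext_of_integral_eq_on_compactlySupported fun g ↦ ?_
    have hgi (ρ : Measure ℝ) [IsProbabilityMeasure ρ] : Integrable g ρ :=
      g.continuous.integrable_of_hasCompactSupport g.hasCompactSupport
    have hint (ρ : Measure ℝ) [IsProbabilityMeasure ρ] (c : ℝ) :
        ∫ x, (g x - c * k x) ∂ρ = ∫ x, g x ∂ρ - c * ∫ x, k x ∂ρ := by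
      rw [integral_sub (hgi ρ) ((hki ρ).const_mul c), integral_const_mul]
    have key := h (fun x ↦ g x - ((∫ x, g x ∂ν) / ∫ x, k x ∂ν) * k x)
      (g.continuous.sub (continuous_const.mul k.continuous))
      (g.hasCompactSupport.sub hks.mul_left)
      (by rw [hint, div_mul_cancel₀ _ hpos.ne', sub_self])
    rw [hint, sub_eq_zero] at key
    rw [integral_smul_nnreal_measure, key, NNReal.smul_def, smul_eq_mul]
    change _ = (∫ x, k x ∂μ) / (∫ x, k x ∂ν) * _
    ring
  have hr : r = 1 := by
    have := DFunLike.congr_fun hμ Set.univ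
    simpa using this.symm
  rw [hμ, hr, one_smul]

/-- Stein's lemma (characterization of the standard normal distribution):
a real-valued random variable `W` has the standard normal distribution `N(0,1)`
if and only if `E[f'(W) - W * f(W)] = 0` for every continuously differentiable
`f : ℝ → ℝ` with both `f` and `f'` bounded. -/
theorem stein_characterization_of_normal
    {Ω : Type*} [MeasurableSpace Ω] (P : Measure Ω) [IsProbabilityMeasure P]
    (W : Ω → ℝ) (hW : Measurable W) :
    Measure.map W P = gaussianReal 0 1 ↔
      ∀ f : ℝ → ℝ, ContDiff ℝ 1 f → (∃ C, ∀ x, |f x| ≤ C) →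
        (∃ C, ∀ x, |deriv f x| ≤ C) →
        ∫ ω, (deriv f (W ω) - W ω * f (W ω)) ∂P = 0 := by
  have hmap (f : ℝ → ℝ) (hf : ContDiff ℝ 1 f) :
      ∫ ω, (deriv f (W ω) - W ω * f (W ω)) ∂P = ∫ x, (deriv f x - x * f x) ∂P.map W :=
    (integral_map hW.aemeasurable ((hf.continuous_deriv le_rfl).sub
      (continuous_id.mul hf.continuous)).aestronglyMeasurable).symm
  constructor
  · intro h f hf hb hb'
    rw [hmap f hf, h]
    exact integral_deriv_sub_id_mul_gaussianReal hf hb hb'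
  · intro h
    have := Measure.isProbabilityMeasure_map hW.aemeasurable (μ := P)
    have := (gaussianReal_absolutelyContinuous' 0 one_ne_zero).isOpenPosMeasure
    refine eq_of_forall_hasCompactSupport_integral_eq_zero fun g hg hgs hg0 ↦ ?_
    obtain ⟨f, hf, hfs, hfg⟩ := exists_hasCompactSupport_stein_equation hg hgs hg0
    have hzero := h f hf (hfs.exists_bound_of_continuous hf.continuous)
      (hfs.deriv.exists_bound_of_continuous (hf.continuous_deriv le_rfl))
    rw [hmap f hf] at hzero
    simpa only [hfg] using hzero
end

section
/- If W has the standard normal distribution and f: ℝ → ℝ is absolutely continuous (i.e., locally absolutely continuous with a.e. derivative f') with E|f'(W)| < ∞, then E[W·f(W)] = E[f'(W)]. -/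
open MeasureTheory ProbabilityTheory

lemma hasDerivAt_neg_gaussianPDFReal_zero_one (x : ℝ) :
    HasDerivAt (fun y => -gaussianPDFReal 0 1 y) (x * gaussianPDFReal 0 1 x) x := by
  have h : HasDerivAt (fun y : ℝ => -(y - 0) ^ 2 / (2 * ((1 : NNReal) : ℝ))) (-x) x := by
    have := (((hasDerivAt_id x).sub_const 0).pow 2).neg.div_const (2 * ((1 : NNReal) : ℝ))
    refine this.congr_deriv ?_
    simp only [id, NNReal.coe_one]
    ring
  have h2 := (h.exp.const_mul ((√(2 * Real.pi * ((1 : NNReal) : ℝ)))⁻¹)).neg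
  refine h2.congr_deriv ?_
  simp only [gaussianPDFReal]
  ring

lemma tendsto_neg_gaussianPDFReal_zero_one :
    Filter.Tendsto (fun y => -gaussianPDFReal 0 1 y) Filter.atTop (nhds 0) := by
  have h : Filter.Tendsto (fun y : ℝ => -(y - 0) ^ 2 / (2 * ((1 : NNReal) : ℝ)))
      Filter.atTop Filter.atBot := by
    have := (Filter.tendsto_pow_atTop (α := ℝ) (n := 2) two_ne_zero).atTop_div_const
      (two_pos : (0 : ℝ) < 2)
    refine (Filter.tendsto_neg_atTop_atBot.comp this).congr fun y => ?_
    simp [neg_div]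
  have h2 := ((Real.tendsto_exp_atBot.comp h).const_mul
    ((√(2 * Real.pi * ((1 : NNReal) : ℝ)))⁻¹)).neg
  simpa [gaussianPDFReal, Function.comp_def] using h2

lemma integrableOn_Ioi_mul_gaussianPDFReal {t : ℝ} (ht : 0 ≤ t) :
    IntegrableOn (fun x => x * gaussianPDFReal 0 1 x) (Set.Ioi t) :=
  integrableOn_Ioi_deriv_of_nonneg'
    (fun x _ => hasDerivAt_neg_gaussianPDFReal_zero_one x)
    (fun x hx => mul_nonneg (ht.trans (le_of_lt hx)) (gaussianPDFReal_nonneg 0 1 x))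
    tendsto_neg_gaussianPDFReal_zero_one

lemma integral_Ioi_mul_gaussianPDFReal {t : ℝ} (ht : 0 ≤ t) :
    ∫ x in Set.Ioi t, x * gaussianPDFReal 0 1 x = gaussianPDFReal 0 1 t := by
  rw [integral_Ioi_of_hasDerivAt_of_tendsto'
    (fun x _ => hasDerivAt_neg_gaussianPDFReal_zero_one x)
    (integrableOn_Ioi_mul_gaussianPDFReal ht) tendsto_neg_gaussianPDFReal_zero_one]
  ring

lemma gaussianPDFReal_zero_neg (v : NNReal) (x : ℝ) :
    gaussianPDFReal 0 v (-x) = gaussianPDFReal 0 v x := by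
  simp [gaussianPDFReal]

/-- The half-line form of Stein's identity, obtained from Fubini's theorem. -/
lemma stein_identity_Ioi {g : ℝ → ℝ}
    (hg : IntegrableOn (fun t => gaussianPDFReal 0 1 t * g t) (Set.Ioi 0)) :
    IntegrableOn (fun x => x * gaussianPDFReal 0 1 x * ∫ t in 0..x, g t) (Set.Ioi 0) ∧
      ∫ x in Set.Ioi 0, x * gaussianPDFReal 0 1 x * ∫ t in 0..x, g t =
        ∫ t in Set.Ioi 0, gaussianPDFReal 0 1 t * g t := by
  have hgm : AEStronglyMeasurable g (volume.restrict (Set.Ioi 0)) := by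
    have h := hg.1.mul
      (measurable_gaussianPDFReal 0 1).inv.aestronglyMeasurable
    refine h.congr (.of_forall fun x => ?_)
    have := (gaussianPDFReal_pos 0 1 x one_ne_zero).ne'
    simp only [Pi.mul_apply, Pi.inv_apply]
    field_simp
  set F : ℝ × ℝ → ℝ := {p | p.2 < p.1}.indicator
    (fun p => p.1 * gaussianPDFReal 0 1 p.1 * g p.2) with hF
  have hset : MeasurableSet {p : ℝ × ℝ | p.2 < p.1} :=
    measurableSet_lt measurable_snd measurable_fst
  have hF_left (x : ℝ) : (fun t => F (x, t)) =
      (Set.Iio x).indicator (fun t => x * gaussianPDFReal 0 1 x * g t) := by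
    ext t
    simp [hF, Set.indicator_apply]
  have hF_right (t : ℝ) : (fun x => F (x, t)) =
      (Set.Ioi t).indicator (fun x => x * gaussianPDFReal 0 1 x * g t) := by
    ext x
    simp [hF, Set.indicator_apply]
  have hinter {t : ℝ} (ht : 0 < t) : Set.Ioi 0 ∩ Set.Ioi t = Set.Ioi t :=
    Set.inter_eq_right.mpr (Set.Ioi_subset_Ioi ht.le)
  have hleft : ∀ x ∈ Set.Ioi (0 : ℝ), ∫ t in Set.Ioi 0, F (x, t) =
      x * gaussianPDFReal 0 1 x * ∫ t in 0..x, g t := by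
    intro x hx
    rw [hF_left, setIntegral_indicator measurableSet_Iio, Set.Ioi_inter_Iio,
      ← integral_Ioc_eq_integral_Ioo, integral_const_mul,
      intervalIntegral.integral_of_le (le_of_lt hx)]
  have hright : ∀ t ∈ Set.Ioi (0 : ℝ), ∫ x in Set.Ioi 0, F (x, t) =
      gaussianPDFReal 0 1 t * g t := by
    intro t ht
    rw [hF_right, setIntegral_indicator measurableSet_Ioi, hinter ht, integral_mul_const,
      integral_Ioi_mul_gaussianPDFReal (le_of_lt ht)]
  have hright_norm : ∀ t ∈ Set.Ioi (0 : ℝ), ‖gaussianPDFReal 0 1 t * g t‖ =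
      ∫ x in Set.Ioi 0, ‖F (x, t)‖ := by
    intro t ht
    have h (x : ℝ) : ‖F (x, t)‖ =
        (Set.Ioi t).indicator (fun x => x * gaussianPDFReal 0 1 x * ‖g t‖) x := by
      rw [congrFun (hF_right t) x, norm_indicator_eq_indicator_norm]
      refine congrFun (Set.indicator_congr fun y hy => ?_) x
      rw [norm_mul, Real.norm_of_nonneg (mul_nonneg (ht.le.trans (le_of_lt hy))
        (gaussianPDFReal_nonneg 0 1 y))]
    simp_rw [h]
    rw [setIntegral_indicator measurableSet_Ioi, hinter ht, integral_mul_const,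
      integral_Ioi_mul_gaussianPDFReal (le_of_lt ht), norm_mul,
      Real.norm_of_nonneg (gaussianPDFReal_nonneg 0 1 t)]
  have hFint : Integrable F ((volume.restrict (Set.Ioi 0)).prod (volume.restrict (Set.Ioi 0))) := by
    have hFm : AEStronglyMeasurable F
        ((volume.restrict (Set.Ioi 0)).prod (volume.restrict (Set.Ioi 0))) :=
      ((measurable_fst.mul ((measurable_gaussianPDFReal 0 1).comp
        measurable_fst)).aestronglyMeasurable.mul hgm.comp_snd).indicator hset
    refine (integrable_prod_iff' hFm).mpr ⟨?_, ?_⟩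
    · filter_upwards [ae_restrict_mem measurableSet_Ioi] with t ht
      rw [hF_right, integrable_indicator_iff measurableSet_Ioi, IntegrableOn,
        Measure.restrict_restrict measurableSet_Ioi, Set.inter_comm, hinter ht]
      exact (integrableOn_Ioi_mul_gaussianPDFReal (le_of_lt ht)).mul_const _
    · refine hg.norm.congr ?_
      filter_upwards [ae_restrict_mem measurableSet_Ioi] with t ht using hright_norm t ht
  refine ⟨hFint.integral_prod_left.congr ?_, ?_⟩
  · filter_upwards [ae_restrict_mem measurableSet_Ioi] with x hx using hleft x hx
  · rw [← setIntegral_congr_fun measurableSet_Ioi hleft,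
      ← setIntegral_congr_fun measurableSet_Ioi hright]
    exact integral_integral_swap hFint

/-- Stein's identity for the Gaussian density, normalized to vanish at the origin. -/
lemma stein_identity_intervalIntegral {g : ℝ → ℝ}
    (hg : Integrable (fun t => gaussianPDFReal 0 1 t * g t)) :
    Integrable (fun x => x * gaussianPDFReal 0 1 x * ∫ t in 0..x, g t) ∧
      ∫ x, x * gaussianPDFReal 0 1 x * ∫ t in 0..x, g t =
        ∫ t, gaussianPDFReal 0 1 t * g t := by
  obtain ⟨hpos, hpos_eq⟩ := stein_identity_Ioi hg.integrableOn
  have hneg_int : IntegrableOn (fun t => gaussianPDFReal 0 1 t * g (-t)) (Set.Ioi 0) := by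
    refine (hg.comp_neg.congr (.of_forall fun t => ?_)).integrableOn
    simp only [gaussianPDFReal_zero_neg]
  obtain ⟨hneg, hneg_eq⟩ := stein_identity_Ioi hneg_int
  have hrefl (x : ℝ) : x * gaussianPDFReal 0 1 x * ∫ t in 0..x, g (-t) =
      -x * gaussianPDFReal 0 1 (-x) * ∫ t in 0..(-x), g t := by
    rw [intervalIntegral.integral_comp_neg, intervalIntegral.integral_symm,
      gaussianPDFReal_zero_neg, neg_zero]
    ring
  simp_rw [hrefl] at hneg hneg_eq
  have hIic : IntegrableOn (fun x => x * gaussianPDFReal 0 1 x * ∫ t in 0..x, g t)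
      (Set.Iic 0) := by
    rw [integrableOn_Iic_iff_integrableOn_Iio]
    have := hneg.comp_neg
    simpa using this
  have hint : Integrable (fun x => x * gaussianPDFReal 0 1 x * ∫ t in 0..x, g t) := by
    rw [← integrableOn_univ, ← Set.Iic_union_Ioi (a := (0 : ℝ))]
    exact hIic.union hpos
  refine ⟨hint, ?_⟩
  rw [← intervalIntegral.integral_Iic_add_Ioi hIic hpos,
    ← intervalIntegral.integral_Iic_add_Ioi (b := 0) hg.integrableOn hg.integrableOn, hpos_eq]
  congr 1
  have h1 := integral_comp_neg_Ioi (0 : ℝ) (fun x => x * gaussianPDFReal 0 1 x * ∫ t in 0..x, g t)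
  have h2 := integral_comp_neg_Ioi (0 : ℝ) (fun t => gaussianPDFReal 0 1 t * g t)
  simp only [neg_zero] at h1 h2
  rw [← h1, ← h2, hneg_eq]
  simp only [gaussianPDFReal_zero_neg]

/-- If `W` has the standard normal distribution and `f : ℝ → ℝ` is absolutely
continuous with a.e. derivative `f'` (in the sense that
`f b - f a = ∫ t in a..b, f' t` for all `a ≤ b`, with `f'` locally integrable)
and `E|f'(W)| < ∞`, then `E[W * f(W)] = E[f'(W)]`. -/
theorem stein_identity_normal
    {Ω : Type*} [MeasurableSpace Ω] (P : Measure Ω) [IsProbabilityMeasure P]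
    (W : Ω → ℝ) (hW : Measurable W)
    (hWlaw : Measure.map W P = gaussianReal 0 1)
    (f f' : ℝ → ℝ)
    (hf'loc : LocallyIntegrable f' volume)
    (hFTC : ∀ a b : ℝ, a ≤ b → f b - f a = ∫ t in a..b, f' t)
    (hInt : Integrable (fun ω => f' (W ω)) P) :
    ∫ ω, W ω * f (W ω) ∂P = ∫ ω, f' (W ω) ∂P := by
  have hftc (x : ℝ) : f x = (∫ t in 0..x, f' t) + f 0 := by
    rcases le_total 0 x with hx | hx
    · linarith [hFTC 0 x hx]
    · rw [intervalIntegral.integral_symm]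
      linarith [hFTC x 0 hx]
  have hf_cont : Continuous f := by
    have h := intervalIntegral.continuous_primitive
      (fun a b => (hf'loc.integrableOn_isCompact isCompact_uIcc).intervalIntegrable) 0
    exact (h.add continuous_const).congr fun x => (hftc x).symm
  have hf'_meas : AEStronglyMeasurable f' (Measure.map W P) := by
    rw [hWlaw]
    exact hf'loc.aestronglyMeasurable.mono_ac (gaussianReal_absolutelyContinuous 0 one_ne_zero)
  have hf'_int : Integrable f' (gaussianReal 0 1) := by
    rw [← hWlaw]
    exact (integrable_map_measure hf'_meas hW.aemeasurable).mpr hInt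
  have hg : Integrable (fun t => gaussianPDFReal 0 1 t * f' t) := by
    rw [gaussianReal_of_var_ne_zero 0 one_ne_zero, integrable_withDensity_iff_integrable_smul'
      (measurable_gaussianPDF 0 1) (.of_forall fun _ => gaussianPDF_lt_top)] at hf'_int
    simpa using hf'_int
  obtain ⟨hint, heq⟩ := stein_identity_intervalIntegral hg
  obtain ⟨hint_id, heq_id⟩ : Integrable (fun x => gaussianPDFReal 0 1 x * x) ∧
      ∫ x, gaussianPDFReal 0 1 x * x = 0 := by
    have h : Integrable (fun x : ℝ => x) (gaussianReal 0 1) :=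
      (memLp_id_gaussianReal 1).integrable le_rfl
    have h0 : ∫ x, x ∂(gaussianReal 0 1) = 0 := integral_id_gaussianReal
    rw [integral_gaussianReal_eq_integral_smul one_ne_zero] at h0
    rw [gaussianReal_of_var_ne_zero 0 one_ne_zero, integrable_withDensity_iff_integrable_smul'
      (measurable_gaussianPDF 0 1) (.of_forall fun _ => gaussianPDF_lt_top)] at h
    exact ⟨by simpa using h, h0⟩
  rw [← integral_map (f := fun x => x * f x) hW.aemeasurable
      (continuous_id.mul hf_cont).aestronglyMeasurable,
    ← integral_map hW.aemeasurable hf'_meas, hWlaw,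
    integral_gaussianReal_eq_integral_smul one_ne_zero,
    integral_gaussianReal_eq_integral_smul one_ne_zero]
  simp only [smul_eq_mul]
  rw [← heq]
  calc ∫ x, gaussianPDFReal 0 1 x * (x * f x)
      = ∫ x, (x * gaussianPDFReal 0 1 x * (∫ t in 0..x, f' t)
          + gaussianPDFReal 0 1 x * x * f 0) := by
        refine integral_congr_ae (.of_forall fun x => ?_)
        simp only
        rw [hftc x]
        ring
    _ = _ := by
        rw [integral_add hint (hint_id.mul_const _), integral_mul_const, heq_id]
        ring
end

section
/- Let Z be standard normal and let h: ℝ → ℝ be bounded and continuous. Define f_h(w) = −e^{w²/2} ∫_w^∞ e^{−t²/2}(h(t) − E h(Z)) dt. Then f_h also equals e^{w²/2} ∫_{−∞}^w e^{−t²/2}(h(t) − E h(Z)) dt, f_h is continuously differentiable, and f_h satisfies the Stein equation f_h'(w) − w·f_h(w) = h(w) − E h(Z) for every w ∈ ℝ. -/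
open MeasureTheory ProbabilityTheory Real

lemma gaussianPDFReal_zero_one (t : ℝ) :
    gaussianPDFReal 0 1 t = (√(2 * π))⁻¹ * Real.exp (-(t ^ 2) / 2) := by
  simp [gaussianPDFReal]

lemma integrable_exp_neg_sq_div_two : Integrable fun t : ℝ => Real.exp (-(t ^ 2) / 2) := by
  refine (integrable_exp_neg_mul_sq (one_half_pos (α := ℝ))).congr (ae_of_all _ fun t => ?_)
  ring_nf

lemma integrable_exp_neg_sq_div_two_mul {g : ℝ → ℝ} (hcont : Continuous g)
    (hbdd : ∃ C, ∀ x, |g x| ≤ C) :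
    Integrable fun t : ℝ => Real.exp (-(t ^ 2) / 2) * g t := by
  obtain ⟨C, hC⟩ := hbdd
  exact integrable_exp_neg_sq_div_two.mul_bdd hcont.aestronglyMeasurable (ae_of_all _ hC)

/-- A bounded continuous function, centred at its Gaussian mean, integrates to zero against the
unnormalised Gaussian density. -/
lemma integral_exp_neg_sq_div_two_mul_sub_eq_zero {h : ℝ → ℝ} (hcont : Continuous h)
    (hbdd : ∃ C, ∀ x, |h x| ≤ C) :
    ∫ t, Real.exp (-(t ^ 2) / 2) * (h t - ∫ s, h s ∂(gaussianReal 0 1)) = 0 := by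
  have hint : Integrable h (gaussianReal 0 1) := by
    obtain ⟨C, hC⟩ := hbdd
    exact Integrable.of_bound hcont.aestronglyMeasurable C (ae_of_all _ hC)
  have hzero : ∫ t, (h t - ∫ s, h s ∂(gaussianReal 0 1)) ∂(gaussianReal 0 1) = 0 := by
    rw [integral_sub hint (integrable_const _)]
    simp
  rw [integral_gaussianReal_eq_integral_smul one_ne_zero] at hzero
  simp only [gaussianPDFReal_zero_one, smul_eq_mul, mul_assoc] at hzero
  rw [integral_const_mul] at hzero
  exact (mul_eq_zero.mp hzero).resolve_left (by positivity)

lemma hasDerivAt_integral_Ioi {g : ℝ → ℝ} (hcont : Continuous g) (hint : Integrable g) (w : ℝ) :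
    HasDerivAt (fun x => ∫ t in Set.Ioi x, g t) (-g w) w := by
  have heq : (fun x => ∫ t in Set.Ioi x, g t) =
      fun x => (∫ t in Set.Ioi 0, g t) - ∫ t in (0 : ℝ)..x, g t := by
    funext x
    rw [← intervalIntegral.integral_Ioi_sub_Ioi' hint.integrableOn hint.integrableOn]
    ring
  rw [heq]
  exact (hcont.integral_hasStrictDerivAt 0 w).hasDerivAt.const_sub _

/-- Properties of the solution of the Stein equation: for bounded continuous
`h : ℝ → ℝ`, with `m = E h(Z)` for `Z` standard normal, the function
`f_h(w) = -e^{w²/2} ∫_w^∞ e^{-t²/2} (h t - m) dt` also equals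
`e^{w²/2} ∫_{-∞}^w e^{-t²/2} (h t - m) dt`, is continuously differentiable,
and satisfies `f_h'(w) - w f_h(w) = h(w) - m` for every `w`. -/
theorem stein_equation_solution
    (h : ℝ → ℝ) (hcont : Continuous h) (hbdd : ∃ C, ∀ x, |h x| ≤ C)
    (m : ℝ) (hm : m = ∫ t, h t ∂(gaussianReal 0 1))
    (f : ℝ → ℝ)
    (hf : ∀ w, f w =
      -(Real.exp (w ^ 2 / 2)) * ∫ t in Set.Ioi w, Real.exp (-(t ^ 2) / 2) * (h t - m)) :
    (∀ w, f w =
        Real.exp (w ^ 2 / 2) * ∫ t in Set.Iio w, Real.exp (-(t ^ 2) / 2) * (h t - m)) ∧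
      ContDiff ℝ 1 f ∧
      ∀ w, deriv f w - w * f w = h w - m := by
  set g : ℝ → ℝ := fun t => Real.exp (-(t ^ 2) / 2) * (h t - m) with hg
  have hgcont : Continuous g := by fun_prop
  have hgint : Integrable g := by
    obtain ⟨C, hC⟩ := hbdd
    exact integrable_exp_neg_sq_div_two_mul (hcont.sub continuous_const)
      ⟨C + |m|, fun x => (abs_sub _ _).trans (by linarith [hC x])⟩
  have hgzero : ∫ t, g t = 0 := by
    rw [hg, hm]
    exact integral_exp_neg_sq_div_two_mul_sub_eq_zero hcont hbdd
  have hderiv (w : ℝ) : HasDerivAt f (w * f w + (h w - m)) w := by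
    have hexp : HasDerivAt (fun x : ℝ => -Real.exp (x ^ 2 / 2)) (-(Real.exp (w ^ 2 / 2) * w)) w := by
      have hsq : HasDerivAt (fun x : ℝ => x ^ 2 / 2) w w := by
        simpa using (hasDerivAt_pow 2 w).div_const 2
      exact hsq.exp.neg
    have hcancel : Real.exp (w ^ 2 / 2) * Real.exp (-(w ^ 2) / 2) = 1 := by
      rw [← Real.exp_add, neg_div, add_neg_cancel, Real.exp_zero]
    rw [funext hf]
    refine (hexp.mul (hasDerivAt_integral_Ioi hgcont hgint w)).congr_deriv ?_
    simp only [hg]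
    linear_combination (h w - m) * hcancel
  have hdiff : Differentiable ℝ f := fun w => (hderiv w).differentiableAt
  refine ⟨fun w => ?_, ?_, fun w => ?_⟩
  · have hsplit : (∫ t in Set.Iic w, g t) + ∫ t in Set.Ioi w, g t = 0 := by
      rw [intervalIntegral.integral_Iic_add_Ioi hgint.integrableOn hgint.integrableOn, hgzero]
    rw [hf w, ← integral_Iic_eq_integral_Iio]
    linear_combination -Real.exp (w ^ 2 / 2) * hsplit
  · rw [contDiff_one_iff_deriv]
    refine ⟨hdiff, ?_⟩
    rw [funext fun w => (hderiv w).deriv]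
    exact (continuous_id.mul hdiff.continuous).add (hcont.sub continuous_const)
  · rw [(hderiv w).deriv]
    ring
end

section
/- Let Z be standard normal and let h: ℝ → ℝ be absolutely continuous with bounded a.e. derivative h'. Let f_h(w) = −e^{w²/2} ∫_w^∞ e^{−t²/2}(h(t) − E h(Z)) dt be the solution of the Stein equation. Then sup_w |f_h(w)| ≤ 2·‖h'‖_∞, sup_w |f_h'(w)| ≤ √(2/π)·‖h'‖_∞, and f_h' is absolutely continuous with a.e. second derivative satisfying |f_h''(w)| ≤ 2·‖h'‖_∞ for a.e. w. -/
open MeasureTheory ProbabilityTheory Real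
open Set Filter Topology

/-- The unnormalised standard Gaussian density. -/
noncomputable def gaussWeight (t : ℝ) : ℝ := Real.exp (-(t ^ 2) / 2)

lemma gaussWeight_pos (t : ℝ) : 0 < gaussWeight t := Real.exp_pos _

lemma gaussWeight_neg (t : ℝ) : gaussWeight (-t) = gaussWeight t := by
  simp [gaussWeight]

lemma continuous_gaussWeight : Continuous gaussWeight := by
  unfold gaussWeight; fun_prop

lemma gaussWeight_eq (t : ℝ) : gaussWeight t = Real.exp (-(1 / 2) * t ^ 2) := by
  unfold gaussWeight; congr 1; ring

lemma hasDerivAt_gaussWeight (t : ℝ) : HasDerivAt gaussWeight (-(t * gaussWeight t)) t := by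
  have h1 : HasDerivAt (fun t : ℝ => -(t ^ 2) / 2) (-t) t := by
    refine (((hasDerivAt_id t).pow 2).neg.div_const 2).congr_deriv ?_
    simp; ring
  exact h1.exp.congr_deriv (by unfold gaussWeight; ring)

lemma integrable_gaussWeight : Integrable gaussWeight := by
  rw [funext gaussWeight_eq]
  exact integrable_exp_neg_mul_sq (by norm_num)

lemma integrable_mul_gaussWeight : Integrable fun t => t * gaussWeight t := by
  simpa [gaussWeight_eq] using integrable_mul_exp_neg_mul_sq (b := 1 / 2) (by norm_num)

lemma integrable_sq_mul_gaussWeight : Integrable fun t => t ^ 2 * gaussWeight t := by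
  simpa [gaussWeight_eq] using
    integrable_rpow_mul_exp_neg_mul_sq (b := 1 / 2) (by norm_num) (s := 2) (by norm_num)

/-- A continuous function of at most linear growth is integrable against the Gaussian weight. -/
lemma integrable_gaussWeight_mul {g : ℝ → ℝ} (hg : Continuous g) {A B : ℝ}
    (hb : ∀ x, |g x| ≤ A + B * |x|) : Integrable fun t => gaussWeight t * g t := by
  refine Integrable.mono' ((integrable_gaussWeight.const_mul A).add
    (integrable_mul_gaussWeight.abs.const_mul B))
    (continuous_gaussWeight.mul hg).aestronglyMeasurable (ae_of_all _ fun t => ?_)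
  have h := mul_le_mul_of_nonneg_left (hb t) (gaussWeight_pos t).le
  simp only [Real.norm_eq_abs, abs_mul, abs_of_pos (gaussWeight_pos t), Pi.add_apply]
  linarith

lemma integral_gaussWeight : ∫ t, gaussWeight t = √(2 * π) := by
  simp_rw [gaussWeight_eq]
  rw [integral_gaussian]
  congr 1; ring

lemma integral_Ioi_gaussWeight_zero : ∫ t in Ioi 0, gaussWeight t = √(2 * π) / 2 := by
  simp_rw [gaussWeight_eq]
  rw [integral_gaussian_Ioi]
  congr 2; ring

lemma integral_Ioi_mul_gaussWeight (w : ℝ) :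
    ∫ t in Ioi w, t * gaussWeight t = gaussWeight w := by
  have hd (x : ℝ) : HasDerivAt (fun t => -gaussWeight t) (x * gaussWeight x) x :=
    (hasDerivAt_gaussWeight x).neg.congr_deriv (neg_neg _)
  rw [integral_Ioi_of_hasDerivAt_of_tendsto' (m := 0) (fun x _ => hd x)
    integrable_mul_gaussWeight.integrableOn]
  · simp
  · exact tendsto_zero_of_hasDerivAt_of_integrableOn_Ioi (a := w) (fun x _ => hd x)
      integrable_mul_gaussWeight.integrableOn integrable_gaussWeight.neg.integrableOn

lemma integral_Ioi_sq_mul_gaussWeight (w : ℝ) :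
    ∫ t in Ioi w, t ^ 2 * gaussWeight t = w * gaussWeight w + ∫ t in Ioi w, gaussWeight t := by
  have hd (x : ℝ) : HasDerivAt (fun t => -(t * gaussWeight t))
      (x ^ 2 * gaussWeight x - gaussWeight x) x :=
    ((hasDerivAt_id x).mul (hasDerivAt_gaussWeight x)).neg.congr_deriv (by simp; ring)
  have hi := integrable_sq_mul_gaussWeight.sub integrable_gaussWeight
  have h := integral_Ioi_of_hasDerivAt_of_tendsto' (m := 0) (a := w) (fun x _ => hd x)
    hi.integrableOn (tendsto_zero_of_hasDerivAt_of_integrableOn_Ioi (a := w) (fun x _ => hd x)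
      hi.integrableOn integrable_mul_gaussWeight.neg.integrableOn)
  rw [integral_sub integrable_sq_mul_gaussWeight.integrableOn
    integrable_gaussWeight.integrableOn] at h
  linarith

lemma integral_Iic_gaussWeight (w : ℝ) :
    ∫ t in Iic w, gaussWeight t = ∫ t in Ioi (-w), gaussWeight t := by
  rw [← integral_comp_neg_Iic]
  simp_rw [gaussWeight_neg]

lemma integral_Iic_mul_gaussWeight (w : ℝ) :
    ∫ t in Iic w, t * gaussWeight t = -gaussWeight w := by
  have h := integral_comp_neg_Iic w fun t => t * gaussWeight t
  simp_rw [gaussWeight_neg, neg_mul] at h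
  rw [integral_neg, integral_Ioi_mul_gaussWeight, gaussWeight_neg] at h
  linarith

lemma integral_Ioi_sub_mul_gaussWeight (w : ℝ) :
    ∫ t in Ioi w, (t - w) * gaussWeight t =
      gaussWeight w - w * ∫ t in Ioi w, gaussWeight t := by
  simp_rw [sub_mul]
  rw [integral_sub integrable_mul_gaussWeight.integrableOn
    (integrable_gaussWeight.const_mul w).integrableOn, integral_Ioi_mul_gaussWeight,
    integral_const_mul]

lemma integral_Iic_sub_mul_gaussWeight (w : ℝ) :
    ∫ t in Iic w, (w - t) * gaussWeight t =
      gaussWeight w + w * ∫ t in Iic w, gaussWeight t := by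
  simp_rw [sub_mul]
  rw [integral_sub (integrable_gaussWeight.const_mul w).integrableOn
    integrable_mul_gaussWeight.integrableOn, integral_Iic_mul_gaussWeight,
    integral_const_mul]
  ring

/-- The upper bound for the Gaussian Mills ratio. -/
lemma mul_integral_Ioi_gaussWeight_le (w : ℝ) :
    w * ∫ t in Ioi w, gaussWeight t ≤ gaussWeight w := by
  have h : 0 ≤ ∫ t in Ioi w, (t - w) * gaussWeight t :=
    setIntegral_nonneg measurableSet_Ioi fun t ht =>
      mul_nonneg (sub_nonneg.2 (le_of_lt ht)) (gaussWeight_pos t).le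
  rw [integral_Ioi_sub_mul_gaussWeight] at h
  linarith

lemma neg_mul_integral_Iic_gaussWeight_le (w : ℝ) :
    -w * ∫ t in Iic w, gaussWeight t ≤ gaussWeight w := by
  rw [integral_Iic_gaussWeight, ← gaussWeight_neg w]
  exact mul_integral_Ioi_gaussWeight_le (-w)

/-- The lower bound for the Gaussian Mills ratio. -/
lemma mul_gaussWeight_le (w : ℝ) :
    w * gaussWeight w ≤ (1 + w ^ 2) * ∫ t in Ioi w, gaussWeight t := by
  have h : 0 ≤ ∫ t in Ioi w, (t - w) ^ 2 * gaussWeight t :=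
    setIntegral_nonneg measurableSet_Ioi fun t _ =>
      mul_nonneg (sq_nonneg _) (gaussWeight_pos t).le
  have e (t : ℝ) : (t - w) ^ 2 * gaussWeight t =
      t ^ 2 * gaussWeight t - 2 * w * (t * gaussWeight t) + w ^ 2 * gaussWeight t := by ring
  simp_rw [e] at h
  rw [integral_add (by exact (integrable_sq_mul_gaussWeight.sub
      (integrable_mul_gaussWeight.const_mul _)).integrableOn)
      (integrable_gaussWeight.const_mul _).integrableOn,
    integral_sub integrable_sq_mul_gaussWeight.integrableOn
      (integrable_mul_gaussWeight.const_mul _).integrableOn,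
    integral_const_mul, integral_const_mul, integral_Ioi_mul_gaussWeight,
    integral_Ioi_sq_mul_gaussWeight] at h
  linarith

lemma neg_mul_gaussWeight_le (w : ℝ) :
    -w * gaussWeight w ≤ (1 + w ^ 2) * ∫ t in Iic w, gaussWeight t := by
  rw [integral_Iic_gaussWeight, ← gaussWeight_neg w, ← neg_sq w]
  exact mul_gaussWeight_le (-w)

lemma integral_Ioi_eq_sub {g : ℝ → ℝ} (hg : Integrable g) (w : ℝ) :
    ∫ t in Ioi w, g t = (∫ t in Ioi 0, g t) - ∫ t in (0)..w, g t := by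
  rw [← intervalIntegral.integral_Ioi_sub_Ioi' hg.integrableOn hg.integrableOn]
  ring

lemma integral_Iic_eq_sub {g : ℝ → ℝ} (hg : Integrable g) (w : ℝ) :
    ∫ t in Iic w, g t = (∫ t, g t) - ∫ t in Ioi w, g t := by
  rw [← intervalIntegral.integral_Iic_add_Ioi hg.integrableOn hg.integrableOn (b := w)]
  ring

lemma integral_gaussWeight_eq_mul (w : ℝ) :
    ∫ t in (0)..w, gaussWeight t = w * ∫ s in (0)..1, gaussWeight (w * s) := by
  simp

lemma gaussWeight_mul_gaussWeight_mul (w s : ℝ) :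
    gaussWeight w * gaussWeight (w * s) = Real.exp (-(w ^ 2 * (1 + s ^ 2)) / 2) := by
  unfold gaussWeight
  rw [← Real.exp_add]; congr 1; ring

lemma hasDerivAt_integral_exp_div (w : ℝ) :
    HasDerivAt (fun w : ℝ => ∫ s in (0 : ℝ)..1, Real.exp (-(w ^ 2 * (1 + s ^ 2)) / 2) / (1 + s ^ 2))
      (∫ s in (0 : ℝ)..1, -w * Real.exp (-(w ^ 2 * (1 + s ^ 2)) / 2)) w := by
  have hne (s : ℝ) : 1 + s ^ 2 ≠ 0 := by positivity
  have hc (x : ℝ) : Continuous fun s : ℝ =>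
      Real.exp (-(x ^ 2 * (1 + s ^ 2)) / 2) / (1 + s ^ 2) :=
    Continuous.div (by fun_prop) (by fun_prop) hne
  refine (intervalIntegral.hasDerivAt_integral_of_dominated_loc_of_deriv_le
    (bound := fun _ => |w| + 1) (Metric.ball_mem_nhds w one_pos)
    (Eventually.of_forall fun x => (hc x).aestronglyMeasurable)
    ((hc w).intervalIntegrable _ _)
    (F' := fun x s => -x * Real.exp (-(x ^ 2 * (1 + s ^ 2)) / 2))
    (Continuous.aestronglyMeasurable (by fun_prop))
    (ae_of_all _ fun s _ x hx => ?_) intervalIntegrable_const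
    (ae_of_all _ fun s _ x _ => ?_)).2
  · have h1 : |x| ≤ |w| + 1 := by
      have := abs_sub_abs_le_abs_sub x w
      rw [Metric.mem_ball, Real.dist_eq] at hx
      linarith
    have h2 : Real.exp (-(x ^ 2 * (1 + s ^ 2)) / 2) ≤ 1 :=
      Real.exp_le_one_iff.2 (by have : 0 ≤ x ^ 2 * (1 + s ^ 2) := by positivity
                                linarith)
    rw [Real.norm_eq_abs, abs_mul, abs_neg, abs_of_pos (Real.exp_pos _)]
    exact (mul_le_of_le_one_right (abs_nonneg x) h2).trans h1
  · have h1 : HasDerivAt (fun x : ℝ => -(x ^ 2 * (1 + s ^ 2)) / 2) (-(x * (1 + s ^ 2))) x := by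
      refine ((((hasDerivAt_id x).pow 2).mul_const (1 + s ^ 2)).neg.div_const 2).congr_deriv ?_
      simp; ring
    refine (h1.exp.div_const (1 + s ^ 2)).congr_deriv ?_
    field_simp [hne s]

/-- The classical expression for the square of the Gaussian error integral. -/
lemma integral_gaussWeight_zero_sq (w : ℝ) :
    (∫ t in (0)..w, gaussWeight t) ^ 2 = π / 2 -
      2 * ∫ s in (0 : ℝ)..1, Real.exp (-(w ^ 2 * (1 + s ^ 2)) / 2) / (1 + s ^ 2) := by
  set J : ℝ → ℝ := fun w =>
    ∫ s in (0 : ℝ)..1, Real.exp (-(w ^ 2 * (1 + s ^ 2)) / 2) / (1 + s ^ 2) with hJ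
  have hU (x : ℝ) : HasDerivAt (fun w => ∫ t in (0)..w, gaussWeight t) (gaussWeight x) x :=
    continuous_gaussWeight.integral_hasStrictDerivAt 0 x |>.hasDerivAt
  have hd (x : ℝ) : HasDerivAt (fun w => (∫ t in (0)..w, gaussWeight t) ^ 2 + 2 * J w) 0 x := by
    refine (((hU x).pow 2).add ((hasDerivAt_integral_exp_div x).const_mul 2)).congr_deriv ?_
    simp_rw [intervalIntegral.integral_const_mul, ← gaussWeight_mul_gaussWeight_mul,
      intervalIntegral.integral_const_mul]
    rw [integral_gaussWeight_eq_mul]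
    ring
  have h0 := is_const_of_deriv_eq_zero (fun x => (hd x).differentiableAt)
    (fun x => (hd x).deriv) w 0
  have hJ0 : J 0 = π / 4 := by
    simp [hJ]
  simp only [hJ0, intervalIntegral.integral_same] at h0
  change _ = π / 2 - 2 * J w
  linarith

lemma gaussWeight_tail_product_le (w : ℝ) :
    (gaussWeight w + w * ∫ t in Iic w, gaussWeight t) *
      (gaussWeight w - w * ∫ t in Ioi w, gaussWeight t) ≤ gaussWeight w := by
  rw [integral_Iic_eq_sub integrable_gaussWeight, integral_Ioi_eq_sub integrable_gaussWeight,
    integral_gaussWeight, integral_Ioi_gaussWeight_zero]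
  set U := ∫ t in (0)..w, gaussWeight t with hU
  set E : ℝ → ℝ := fun s => Real.exp (-(w ^ 2 * (1 + s ^ 2)) / 2) with hE
  have hne (s : ℝ) : 1 + s ^ 2 ≠ 0 := by positivity
  have hEc : Continuous E := by fun_prop
  have hsq : √(2 * π) ^ 2 = 2 * π := Real.sq_sqrt (by positivity)
  have hUsq : U ^ 2 = π / 2 - 2 * ∫ s in (0 : ℝ)..1, E s / (1 + s ^ 2) :=
    integral_gaussWeight_zero_sq w
  have hwU : gaussWeight w * U = w * ∫ s in (0 : ℝ)..1, E s := by
    simp_rw [hE, ← gaussWeight_mul_gaussWeight_mul, intervalIntegral.integral_const_mul]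
    rw [hU, integral_gaussWeight_eq_mul]
    ring
  have hd (s : ℝ) : HasDerivAt (fun s => (E s - gaussWeight w) * (2 * s / (1 + s ^ 2)))
      (-(2 * w ^ 2 * (E s - E s / (1 + s ^ 2))) +
        (E s - gaussWeight w) * (2 * (1 - s ^ 2) / (1 + s ^ 2) ^ 2)) s := by
    have h1 : HasDerivAt (fun s : ℝ => -(w ^ 2 * (1 + s ^ 2)) / 2) (-(w ^ 2 * s)) s := by
      refine (((((hasDerivAt_id s).pow 2).const_add 1).const_mul (w ^ 2)).neg.div_const
        2).congr_deriv ?_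
      simp; ring
    have h2 : HasDerivAt (fun s : ℝ => 2 * s / (1 + s ^ 2))
        (2 * (1 - s ^ 2) / (1 + s ^ 2) ^ 2) s := by
      refine (((hasDerivAt_id s).const_mul 2).div (((hasDerivAt_id s).pow 2).const_add 1)
        (hne s)).congr_deriv ?_
      simp; ring
    refine ((h1.exp.sub_const (gaussWeight w)).mul h2).congr_deriv ?_
    simp only [hE]
    field_simp [hne s]
    ring
  have hc1 : Continuous fun s => E s / (1 + s ^ 2) := hEc.div (by fun_prop) hne
  have hc2 : Continuous fun s => (E s - gaussWeight w) * (2 * (1 - s ^ 2) / (1 + s ^ 2) ^ 2) :=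
    (hEc.sub continuous_const).mul
      (Continuous.div (by fun_prop) (by fun_prop) fun s => pow_ne_zero 2 (hne s))
  have hc3 : Continuous fun s => -(2 * w ^ 2 * (E s - E s / (1 + s ^ 2))) := by fun_prop
  have hftc := intervalIntegral.integral_eq_sub_of_hasDerivAt (a := 0) (b := 1) (fun s _ => hd s)
    ((hc3.add hc2).intervalIntegrable _ _)
  rw [intervalIntegral.integral_add (hc3.intervalIntegrable _ _) (hc2.intervalIntegrable _ _),
    intervalIntegral.integral_neg, intervalIntegral.integral_const_mul,
    intervalIntegral.integral_sub (hEc.intervalIntegrable _ _) (hc1.intervalIntegrable _ _)] at hftc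
  have hneg : ∫ s in (0 : ℝ)..1,
      (E s - gaussWeight w) * (2 * (1 - s ^ 2) / (1 + s ^ 2) ^ 2) ≤ 0 := by
    rw [← neg_nonneg, ← intervalIntegral.integral_neg]
    refine intervalIntegral.integral_nonneg zero_le_one fun s hs => neg_nonneg.2 ?_
    refine mul_nonpos_of_nonpos_of_nonneg (sub_nonpos.2 (Real.exp_le_exp.2 ?_)) ?_
    · nlinarith [mul_nonneg (sq_nonneg w) (sq_nonneg s)]
    · have : 0 ≤ 1 - s ^ 2 := by nlinarith [hs.1, hs.2]
      positivity
  have hE1 : E 1 = gaussWeight w ^ 2 := by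
    have := gaussWeight_mul_gaussWeight_mul w 1
    rw [mul_one] at this
    rw [sq, this]
  rw [hE1] at hftc
  norm_num at hftc
  linear_combination hneg - hftc + 2 * w * hwU + w ^ 2 * hUsq - w ^ 2 / 4 * hsq

/-- A monotone function with Gaussian mean zero has nonnegative upper Gaussian tail integrals. -/
lemma Monotone.le_integral_Ioi_gaussWeight_mul {g : ℝ → ℝ} (hmono : Monotone g)
    (hg : Integrable fun t => gaussWeight t * g t) (h0 : ∫ t, gaussWeight t * g t = 0) (w : ℝ) :
    0 ≤ ∫ t in Ioi w, gaussWeight t * g t ∧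
      w * g w * gaussWeight w ≤ (1 + w ^ 2) * ∫ t in Ioi w, gaussWeight t * g t := by
  have hQ : g w * ∫ t in Ioi w, gaussWeight t ≤ ∫ t in Ioi w, gaussWeight t * g t := by
    rw [← integral_const_mul]
    refine setIntegral_mono_on (integrable_gaussWeight.const_mul _).integrableOn
      hg.integrableOn measurableSet_Ioi fun t ht => ?_
    rw [mul_comm]
    exact mul_le_mul_of_nonneg_left (hmono (le_of_lt ht)) (gaussWeight_pos t).le
  have hP : ∫ t in Iic w, gaussWeight t * g t ≤ g w * ∫ t in Iic w, gaussWeight t := by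
    rw [← integral_const_mul]
    refine setIntegral_mono_on hg.integrableOn (integrable_gaussWeight.const_mul _).integrableOn
      measurableSet_Iic fun t ht => ?_
    rw [mul_comm (g w)]
    exact mul_le_mul_of_nonneg_left (hmono ht) (gaussWeight_pos t).le
  rw [integral_Iic_eq_sub hg, h0] at hP
  have hw : 0 ≤ 1 + w ^ 2 := by positivity
  rcases le_total 0 (g w) with h | h
  · have hQ0 : 0 ≤ ∫ t in Ioi w, gaussWeight t := integral_nonneg fun t => (gaussWeight_pos t).le
    exact ⟨(mul_nonneg h hQ0).trans hQ, by
      linarith [mul_le_mul_of_nonneg_left (mul_gaussWeight_le w) h,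
        mul_le_mul_of_nonneg_left hQ hw]⟩
  · have hP0 : 0 ≤ ∫ t in Iic w, gaussWeight t := integral_nonneg fun t => (gaussWeight_pos t).le
    exact ⟨by linarith [mul_nonpos_of_nonpos_of_nonneg h hP0], by
      linarith [mul_le_mul_of_nonpos_left (neg_mul_gaussWeight_le w) h,
        mul_le_mul_of_nonneg_left hP hw]⟩

section Lipschitz

variable {k : ℝ → ℝ} {C : ℝ}

lemma continuous_of_abs_sub_le (hk : ∀ x y, |k x - k y| ≤ C * |x - y|) : Continuous k :=
  (LipschitzWith.of_dist_le' (K := C) hk).continuous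

lemma integrable_gaussWeight_mul_of_abs_sub_le (hk : ∀ x y, |k x - k y| ≤ C * |x - y|) :
    Integrable fun t => gaussWeight t * k t := by
  refine integrable_gaussWeight_mul (continuous_of_abs_sub_le hk) (A := |k 0|) (B := C) fun x => ?_
  have h1 := hk x 0
  have h2 := abs_sub_abs_le_abs_sub (k x) (k 0)
  rw [sub_zero] at h1
  linarith

lemma integral_Ioi_gaussWeight_mul_le (hk : ∀ x y, |k x - k y| ≤ C * |x - y|)
    (h0 : ∫ t, gaussWeight t * k t = 0) (w : ℝ) :
    ∫ t in Ioi w, gaussWeight t * k t ≤ C * gaussWeight w ∧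
      (1 + w ^ 2) * (∫ t in Ioi w, gaussWeight t * k t) - w * gaussWeight w * k w ≤
        C * gaussWeight w := by
  have hint := integrable_gaussWeight_mul_of_abs_sub_le hk
  have hmono : Monotone fun t => C * t - k t := fun x y hxy => by
    have h1 := (le_abs_self _).trans (hk y x)
    rw [abs_of_nonneg (sub_nonneg.2 hxy)] at h1
    simp only
    linarith
  have e (t : ℝ) : gaussWeight t * (C * t - k t) =
      C * (t * gaussWeight t) - gaussWeight t * k t := by ring
  have hC := integrable_mul_gaussWeight.const_mul C
  have hmean : ∫ t, t * gaussWeight t = 0 := by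
    rw [← intervalIntegral.integral_Iic_add_Ioi (b := 0) integrable_mul_gaussWeight.integrableOn
      integrable_mul_gaussWeight.integrableOn, integral_Iic_mul_gaussWeight,
      integral_Ioi_mul_gaussWeight, neg_add_cancel]
  have h := hmono.le_integral_Ioi_gaussWeight_mul (by simp_rw [e]; exact hC.sub hint)
    (by simp_rw [e]; rw [integral_sub hC hint, h0, integral_const_mul, hmean]; simp) w
  simp_rw [e] at h
  rw [integral_sub hC.integrableOn hint.integrableOn, integral_const_mul,
    integral_Ioi_mul_gaussWeight] at h
  exact ⟨by linarith [h.1], by linarith [h.2]⟩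

lemma abs_integral_Ioi_gaussWeight_mul_le (hk : ∀ x y, |k x - k y| ≤ C * |x - y|)
    (h0 : ∫ t, gaussWeight t * k t = 0) (w : ℝ) :
    |∫ t in Ioi w, gaussWeight t * k t| ≤ C * gaussWeight w ∧
      |(1 + w ^ 2) * (∫ t in Ioi w, gaussWeight t * k t) - w * gaussWeight w * k w| ≤
        C * gaussWeight w := by
  have h1 := integral_Ioi_gaussWeight_mul_le hk h0 w
  have h2 := integral_Ioi_gaussWeight_mul_le (k := fun t => -k t)
    (fun x y => by rw [← abs_neg]; convert hk x y using 2; ring)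
    (by simp_rw [mul_neg]; rw [integral_neg, h0, neg_zero]) w
  simp_rw [mul_neg] at h2
  rw [integral_neg] at h2
  exact ⟨abs_le.2 ⟨by linarith [h2.1], h1.1⟩, abs_le.2 ⟨by linarith [h2.2], h1.2⟩⟩

lemma abs_gaussWeight_mul_sub_le (hk : ∀ x y, |k x - k y| ≤ C * |x - y|)
    (h0 : ∫ t, gaussWeight t * k t = 0) (w : ℝ) :
    |gaussWeight w * k w - w * ∫ t in Ioi w, gaussWeight t * k t| ≤
      √(2 / π) * C * gaussWeight w := by
  have hint := integrable_gaussWeight_mul_of_abs_sub_le hk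
  have hint' : Integrable fun t => gaussWeight t * (k t - k w) :=
    integrable_gaussWeight_mul_of_abs_sub_le (C := C) fun x y => by simpa using hk x y
  set P := gaussWeight w + w * ∫ t in Iic w, gaussWeight t with hP
  set R := gaussWeight w - w * ∫ t in Ioi w, gaussWeight t with hR
  have hP0 : 0 ≤ P := by linarith [neg_mul_integral_Iic_gaussWeight_le w]
  have hR0 : 0 ≤ R := by linarith [mul_integral_Ioi_gaussWeight_le w]
  have hA : |∫ t in Iic w, gaussWeight t * (k t - k w)| ≤ C * P := by
    rw [hP, ← integral_Iic_sub_mul_gaussWeight, ← integral_const_mul, ← Real.norm_eq_abs]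
    refine norm_integral_le_of_norm_le ?_ ((ae_restrict_iff' measurableSet_Iic).2
      (ae_of_all _ fun t ht => ?_))
    · simp_rw [sub_mul]
      exact (((integrable_gaussWeight.const_mul w).sub
        integrable_mul_gaussWeight).const_mul C).integrableOn
    · have h := hk t w
      rw [abs_sub_comm t, abs_of_nonneg (sub_nonneg.2 (show t ≤ w from ht))] at h
      rw [Real.norm_eq_abs, abs_mul, abs_of_pos (gaussWeight_pos t)]
      linarith [mul_le_mul_of_nonneg_left h (gaussWeight_pos t).le]
  have hB : |∫ t in Ioi w, gaussWeight t * (k t - k w)| ≤ C * R := by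
    rw [hR, ← integral_Ioi_sub_mul_gaussWeight, ← integral_const_mul, ← Real.norm_eq_abs]
    refine norm_integral_le_of_norm_le ?_ ((ae_restrict_iff' measurableSet_Ioi).2
      (ae_of_all _ fun t ht => ?_))
    · simp_rw [sub_mul]
      exact ((integrable_mul_gaussWeight.sub
        (integrable_gaussWeight.const_mul w)).const_mul C).integrableOn
    · have h := hk t w
      rw [abs_of_nonneg (sub_nonneg.2 (show w ≤ t from le_of_lt ht))] at h
      rw [Real.norm_eq_abs, abs_mul, abs_of_pos (gaussWeight_pos t)]
      linarith [mul_le_mul_of_nonneg_left h (gaussWeight_pos t).le]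
  have hAk := integral_Iic_eq_sub hint w
  have hPhi := integral_Iic_eq_sub integrable_gaussWeight w
  rw [h0] at hAk
  rw [integral_gaussWeight] at hPhi
  have e (t : ℝ) : gaussWeight t * (k t - k w) = gaussWeight t * k t - k w * gaussWeight t := by
    ring
  simp_rw [e] at hA hB
  rw [integral_sub hint.integrableOn (integrable_gaussWeight.const_mul _).integrableOn,
    integral_const_mul] at hA hB
  set N := √(2 * π) with hN
  have hN0 : 0 < N := by positivity
  have hNC : √(2 / π) * N = 2 := by
    rw [hN, ← Real.sqrt_mul (by positivity)]
    rw [show 2 / π * (2 * π) = 2 ^ 2 by field_simp]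
    exact Real.sqrt_sq (by norm_num)
  have hC0 : 0 ≤ C := by simpa using (abs_nonneg _).trans (hk 1 0)
  set G := ∫ t in Ioi w, gaussWeight t * k t
  set Q := ∫ t in Ioi w, gaussWeight t
  set Φ := ∫ t in Iic w, gaussWeight t
  set A := (∫ t in Iic w, gaussWeight t * k t) - k w * Φ with hAdef
  have key : N * (gaussWeight w * k w - w * G) = -(A * R) - (G - k w * Q) * P := by
    rw [hAdef, hAk, hP, hR, hPhi]
    ring
  have hbound : |N * (gaussWeight w * k w - w * G)| ≤ 2 * C * gaussWeight w := by
    rw [key]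
    calc |-(A * R) - (G - k w * Q) * P| ≤ |A| * R + |G - k w * Q| * P := by
          refine (abs_sub _ _).trans_eq ?_
          rw [abs_neg, abs_mul, abs_mul, abs_of_nonneg hR0, abs_of_nonneg hP0]
      _ ≤ C * P * R + C * R * P := by gcongr
      _ = 2 * C * (P * R) := by ring
      _ ≤ 2 * C * gaussWeight w := by
          gcongr
          exact gaussWeight_tail_product_le w
  rw [abs_mul, abs_of_pos hN0] at hbound
  refine le_of_mul_le_mul_left (hbound.trans_eq ?_) hN0
  linear_combination -(C * gaussWeight w) * hNC

end Lipschitz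

lemma abs_sub_le_of_integral {h h' : ℝ → ℝ} {C : ℝ}
    (hFTC : ∀ a b : ℝ, a ≤ b → h b - h a = ∫ t in a..b, h' t) (hC : ∀ x, |h' x| ≤ C) (x y : ℝ) :
    |h x - h y| ≤ C * |x - y| := by
  wlog hxy : y ≤ x generalizing x y
  · rw [abs_sub_comm, abs_sub_comm x]
    exact this y x (le_of_not_ge hxy)
  rw [hFTC y x hxy, ← Real.norm_eq_abs]
  exact intervalIntegral.norm_integral_le_of_norm_le_const fun t _ => hC t

lemma integral_gaussWeight_mul_sub_mean {h : ℝ → ℝ}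
    (hh : Integrable fun t => gaussWeight t * h t) :
    ∫ t, gaussWeight t * (h t - ∫ s, h s ∂(gaussianReal 0 1)) = 0 := by
  have hm : ∫ s, h s ∂(gaussianReal 0 1) = (√(2 * π))⁻¹ * ∫ t, gaussWeight t * h t := by
    rw [integral_gaussianReal_eq_integral_smul one_ne_zero, ← integral_const_mul]
    simp [gaussianPDFReal, gaussWeight, mul_assoc]
  simp_rw [mul_sub]
  rw [integral_sub hh (integrable_gaussWeight.mul_const _), integral_mul_const,
    integral_gaussWeight, hm, mul_inv_cancel_left₀ (by positivity), sub_self]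

/-- The Stein solution satisfies the Stein equation. -/
lemma hasDerivAt_stein_solution {k f : ℝ → ℝ} (hk : Continuous k)
    (hint : Integrable fun t => gaussWeight t * k t)
    (hf : ∀ w, f w = -(Real.exp (w ^ 2 / 2)) * ∫ t in Ioi w, gaussWeight t * k t) (w : ℝ) :
    HasDerivAt f (w * f w + k w) w := by
  have hE : HasDerivAt (fun w : ℝ => -(Real.exp (w ^ 2 / 2))) (-(Real.exp (w ^ 2 / 2) * w)) w := by
    have h1 : HasDerivAt (fun w : ℝ => w ^ 2 / 2) w w :=
      (((hasDerivAt_id w).pow 2).div_const 2).congr_deriv (by simp)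
    exact h1.exp.neg
  have hG : HasDerivAt (fun w => ∫ t in Ioi w, gaussWeight t * k t) (-(gaussWeight w * k w)) w := by
    rw [funext (integral_Ioi_eq_sub hint)]
    exact ((continuous_gaussWeight.mul hk).integral_hasStrictDerivAt 0 w).hasDerivAt.const_sub _
  have he : Real.exp (w ^ 2 / 2) * gaussWeight w = 1 := by
    rw [gaussWeight, ← Real.exp_add, neg_div, add_neg_cancel, Real.exp_zero]
  rw [funext hf]
  refine (hE.mul hG).congr_deriv ?_
  linear_combination k w * he

/-- Bounds for the solution of the Stein equation for absolutely continuous `h`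
with bounded a.e. derivative `h'`: the solution
`f_h(w) = -e^{w²/2} ∫_w^∞ e^{-t²/2}(h t - E h(Z)) dt` satisfies
`‖f_h‖_∞ ≤ 2‖h'‖_∞`, `‖f_h'‖_∞ ≤ √(2/π)‖h'‖_∞`, and `f_h'` is absolutely
continuous with a.e. second derivative bounded by `2‖h'‖_∞`. -/
theorem stein_equation_solution_bounds_lipschitz_h
    (h h' : ℝ → ℝ)
    (hloc : LocallyIntegrable h' volume)
    (hFTC : ∀ a b : ℝ, a ≤ b → h b - h a = ∫ t in a..b, h' t)
    (C : ℝ) (hC : ∀ x, |h' x| ≤ C)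
    (m : ℝ) (hm : m = ∫ t, h t ∂(gaussianReal 0 1))
    (f : ℝ → ℝ)
    (hf : ∀ w, f w =
      -(Real.exp (w ^ 2 / 2)) * ∫ t in Set.Ioi w, Real.exp (-(t ^ 2) / 2) * (h t - m)) :
    (∀ w, |f w| ≤ 2 * C) ∧
      (∀ w, |deriv f w| ≤ Real.sqrt (2 / Real.pi) * C) ∧
      (∃ f'' : ℝ → ℝ, LocallyIntegrable f'' volume ∧
        (∀ a b : ℝ, a ≤ b → deriv f b - deriv f a = ∫ t in a..b, f'' t) ∧
        (∀ᵐ w ∂(volume : Measure ℝ), |f'' w| ≤ 2 * C)) := by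
  set k : ℝ → ℝ := fun t => h t - m with hk
  have hC0 : 0 ≤ C := (abs_nonneg _).trans (hC 0)
  have hlip := abs_sub_le_of_integral hFTC hC
  have hklip (x y : ℝ) : |k x - k y| ≤ C * |x - y| := by simpa [hk] using hlip x y
  have hkc := continuous_of_abs_sub_le hklip
  have hint := integrable_gaussWeight_mul_of_abs_sub_le hklip
  have h0 : ∫ t, gaussWeight t * k t = 0 := by
    rw [hk, hm]
    exact integral_gaussWeight_mul_sub_mean (integrable_gaussWeight_mul_of_abs_sub_le hlip)
  have hd (w : ℝ) : HasDerivAt f (w * f w + k w) w := hasDerivAt_stein_solution hkc hint hf w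
  have hfc : Continuous f := continuous_iff_continuousAt.2 fun w => (hd w).continuousAt
  have hfG (w : ℝ) : gaussWeight w * f w = -∫ t in Ioi w, gaussWeight t * k t := by
    have he : gaussWeight w * Real.exp (w ^ 2 / 2) = 1 := by
      rw [gaussWeight, ← Real.exp_add, neg_div, neg_add_cancel, Real.exp_zero]
    rw [hf, neg_mul, mul_neg, ← mul_assoc, he, one_mul]
    rfl
  have hdiv {x B w : ℝ} (hx : |gaussWeight w * x| ≤ B * gaussWeight w) : |x| ≤ B := by
    rw [abs_mul, abs_of_pos (gaussWeight_pos w), mul_comm] at hx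
    exact le_of_mul_le_mul_right hx (gaussWeight_pos w)
  have hbound (w : ℝ) := abs_integral_Ioi_gaussWeight_mul_le hklip h0 w
  have hderiv : deriv f = fun w => w * f w + k w := funext fun w => (hd w).deriv
  have hcont : Continuous fun w => f w + w * (w * f w + k w) := by fun_prop
  refine ⟨fun w => ?_, fun w => ?_, fun w => f w + w * (w * f w + k w) + h' w,
    hcont.locallyIntegrable.add hloc, fun a b hab => ?_, ae_of_all _ fun w => ?_⟩
  · have : |f w| ≤ C := hdiv (w := w) (by rw [hfG, abs_neg]; exact (hbound w).1)
    linarith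
  · rw [hderiv]
    refine hdiv (w := w) ?_
    convert abs_gaussWeight_mul_sub_le hklip h0 w using 2
    linear_combination w * hfG w
  · have hd2 (w : ℝ) : HasDerivAt (fun w => w * f w) (f w + w * (w * f w + k w)) w :=
      ((hasDerivAt_id w).mul (hd w)).congr_deriv (by simp)
    rw [intervalIntegral.integral_add (hcont.intervalIntegrable _ _)
      ((hloc.integrableOn_isCompact isCompact_uIcc).intervalIntegrable), ← hFTC a b hab,
      intervalIntegral.integral_eq_sub_of_hasDerivAt (fun w _ => hd2 w)
        (hcont.intervalIntegrable _ _), hderiv]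
    simp only [hk]
    ring
  · have h1 : |f w + w * (w * f w + k w)| ≤ C := by
      refine hdiv (w := w) ?_
      rw [← abs_neg]
      convert (hbound w).2 using 2
      linear_combination -(1 + w ^ 2) * hfG w
    linarith [abs_add_le (f w + w * (w * f w + k w)) (h' w), hC w]
end

section
/- Fix x ∈ ℝ, let h = 1_{(−∞,x]} be the indicator of (−∞,x], let Z be standard normal, and let f_x(w) = −e^{w²/2} ∫_w^∞ e^{−t²/2}(h(t) − P(Z ≤ x)) dt be the corresponding solution of the Stein equation. Then for all w ∈ ℝ: 0 < f_x(w) ≤ √(2π)/4, |w·f_x(w)| ≤ 1, and |w·f_x(w) − (h(w) − P(Z ≤ x))| ≤ 1 (equivalently, the one-sided derivatives f_x'(w) = w f_x(w) + h(w) − P(Z ≤ x) satisfy |f_x'(w)| ≤ 1). -/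
open MeasureTheory ProbabilityTheory Real

/-- The unnormalised upper tail of the standard normal distribution. -/
noncomputable def gaussianTail (w : ℝ) : ℝ := ∫ t in Set.Ioi w, Real.exp (-(t ^ 2) / 2)

lemma continuous_exp_neg_sq_div_two : Continuous fun t : ℝ => Real.exp (-(t ^ 2) / 2) := by
  fun_prop

lemma gaussianTail_pos (w : ℝ) : 0 < gaussianTail w := by
  have : NeZero ((volume : Measure ℝ).restrict (Set.Ioi w)) :=
    ⟨by simp [Measure.restrict_eq_zero]⟩
  exact integral_exp_pos integrable_exp_neg_sq_div_two.integrableOn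

lemma setIntegral_Iic_eq_gaussianTail_neg (w : ℝ) :
    ∫ t in Set.Iic w, Real.exp (-(t ^ 2) / 2) = gaussianTail (-w) := by
  have h := integral_comp_neg_Iic w fun t => Real.exp (-(t ^ 2) / 2)
  simpa [gaussianTail] using h

lemma gaussianTail_add_gaussianTail_neg (w : ℝ) :
    gaussianTail w + gaussianTail (-w) = √(2 * π) := by
  have h := integral_add_compl (s := Set.Ioi w) measurableSet_Ioi integrable_exp_neg_sq_div_two
  rw [Set.compl_Ioi, setIntegral_Iic_eq_gaussianTail_neg] at h
  rw [gaussianTail, h]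
  have := integral_gaussian (1 / 2)
  rw [show π / (1 / 2) = 2 * π by ring] at this
  rw [← this]
  congr with t
  ring_nf

lemma gaussianTail_anti : Antitone gaussianTail := fun _ _ hab =>
  setIntegral_mono_set integrable_exp_neg_sq_div_two.integrableOn
    (ae_of_all _ fun _ => (Real.exp_pos _).le) (Set.Ioi_subset_Ioi hab).eventuallyLE

/-- The Mills ratio bound. -/
lemma mul_gaussianTail_le (w : ℝ) : w * gaussianTail w ≤ Real.exp (-(w ^ 2) / 2) := by
  have hint : Integrable fun t : ℝ => t * Real.exp (-(t ^ 2) / 2) := by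
    refine (integrable_mul_exp_neg_mul_sq (b := 1 / 2) (by norm_num)).congr
      (ae_of_all _ fun t => ?_)
    ring_nf
  have hderiv : ∀ t ∈ Set.Ici w, HasDerivAt (fun t : ℝ => -Real.exp (-(t ^ 2) / 2))
      (t * Real.exp (-(t ^ 2) / 2)) t := fun t _ => by
    have h := ((((hasDerivAt_id t).pow 2).neg.div_const 2).exp).neg
    convert! h using 1
    simp
    ring
  have hlim : Filter.Tendsto (fun t : ℝ => -Real.exp (-(t ^ 2) / 2)) Filter.atTop (nhds 0) := by
    rw [← neg_zero]
    refine (Real.tendsto_exp_atBot.comp ?_).neg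
    refine Filter.Tendsto.atBot_div_const (by norm_num) ?_
    exact Filter.tendsto_neg_atTop_atBot.comp (Filter.tendsto_pow_atTop two_ne_zero)
  have h := integral_Ioi_of_hasDerivAt_of_tendsto' hderiv hint.integrableOn hlim
  rw [zero_sub, neg_neg] at h
  rw [← h, gaussianTail, ← integral_const_mul]
  refine setIntegral_mono_on (integrable_exp_neg_sq_div_two.integrableOn.const_mul w)
    hint.integrableOn measurableSet_Ioi fun t ht => ?_
  exact mul_le_mul_of_nonneg_right (le_of_lt ht) (Real.exp_pos _).le

lemma sq_integral_exp_neg_sq_div_two_add (w : ℝ) :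
    (∫ t in (0 : ℝ)..w, Real.exp (-(t ^ 2) / 2)) ^ 2 +
      2 * ∫ s in (0 : ℝ)..1, Real.exp (-(w ^ 2) * (1 + s ^ 2) / 2) / (1 + s ^ 2) = π / 2 := by
  have hA : ∀ w : ℝ, HasDerivAt (fun w => ∫ t in (0 : ℝ)..w, Real.exp (-(t ^ 2) / 2))
      (Real.exp (-(w ^ 2) / 2)) w := fun w =>
    continuous_exp_neg_sq_div_two.integral_hasStrictDerivAt 0 w |>.hasDerivAt
  have hpos : ∀ s : ℝ, 1 + s ^ 2 ≠ 0 := fun s => by positivity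
  have hG : ∀ w : ℝ, HasDerivAt
      (fun w => ∫ s in (0 : ℝ)..1, Real.exp (-(w ^ 2) * (1 + s ^ 2) / 2) / (1 + s ^ 2))
      (∫ s in (0 : ℝ)..1, -w * Real.exp (-(w ^ 2) * (1 + s ^ 2) / 2)) w := fun w => by
    have hF (u : ℝ) :
        Continuous fun s : ℝ => Real.exp (-(u ^ 2) * (1 + s ^ 2) / 2) / (1 + s ^ 2) := by
      fun_prop (disch := exact hpos _)
    have hF' : Continuous fun s : ℝ => -w * Real.exp (-(w ^ 2) * (1 + s ^ 2) / 2) := by fun_prop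
    refine (intervalIntegral.hasDerivAt_integral_of_dominated_loc_of_deriv_le
      (F' := fun w s => -w * Real.exp (-(w ^ 2) * (1 + s ^ 2) / 2))
      (bound := fun _ => |w| + 1)
      (Metric.ball_mem_nhds w one_pos) (.of_forall fun u => (hF u).aestronglyMeasurable)
      ((hF w).intervalIntegrable _ _) hF'.aestronglyMeasurable
      (.of_forall fun s _ u hu => ?_) (by simp) (.of_forall fun s _ u _ => ?_)).2
    · rw [norm_mul, Real.norm_eq_abs, Real.norm_eq_abs, Real.abs_exp, abs_neg]
      rw [Metric.mem_ball, Real.dist_eq] at hu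
      have h1 : Real.exp (-(u ^ 2) * (1 + s ^ 2) / 2) ≤ 1 := by
        rw [Real.exp_le_one_iff]
        have : 0 ≤ u ^ 2 * (1 + s ^ 2) := by positivity
        linarith
      have h2 : |u| ≤ |w| + 1 := by
        have := abs_sub_abs_le_abs_sub u w
        linarith
      exact (mul_le_of_le_one_right (abs_nonneg u) h1).trans h2
    · have h := (((((hasDerivAt_id u).pow 2).neg.mul_const (1 + s ^ 2)).div_const 2).exp).div_const
        (1 + s ^ 2)
      convert! h using 1
      have := hpos s
      simp
      field_simp
  have hderiv : ∀ w : ℝ, HasDerivAt (fun w => (∫ t in (0 : ℝ)..w, Real.exp (-(t ^ 2) / 2)) ^ 2 +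
      2 * ∫ s in (0 : ℝ)..1, Real.exp (-(w ^ 2) * (1 + s ^ 2) / 2) / (1 + s ^ 2)) 0 w := by
    intro w
    convert! ((hA w).pow 2).add ((hG w).const_mul 2) using 1
    have hsub : w * ∫ s in (0 : ℝ)..1, Real.exp (-((w * s) ^ 2) / 2) =
        ∫ t in (0 : ℝ)..w, Real.exp (-(t ^ 2) / 2) := by
      simpa using intervalIntegral.mul_integral_comp_mul_left (a := 0) (b := 1)
        (f := fun t => Real.exp (-(t ^ 2) / 2)) w
    have hfac : ∫ s in (0 : ℝ)..1, -w * Real.exp (-(w ^ 2) * (1 + s ^ 2) / 2) =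
        -Real.exp (-(w ^ 2) / 2) * (w * ∫ s in (0 : ℝ)..1, Real.exp (-((w * s) ^ 2) / 2)) := by
      rw [← intervalIntegral.integral_const_mul, ← intervalIntegral.integral_const_mul]
      congr with s
      rw [show -(w ^ 2) * (1 + s ^ 2) / 2 = -(w ^ 2) / 2 + -((w * s) ^ 2) / 2 by ring,
        Real.exp_add]
      ring
    rw [hfac, hsub]
    simp
    ring
  have hconst := is_const_of_deriv_eq_zero (fun w => (hderiv w).differentiableAt)
    (fun w => (hderiv w).deriv) w 0
  rw [hconst]
  simp
  ring

lemma gaussianTail_mul_gaussianTail_neg_le (w : ℝ) :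
    gaussianTail w * gaussianTail (-w) ≤ π / 2 * Real.exp (-(w ^ 2) / 2) := by
  have hsum := gaussianTail_add_gaussianTail_neg w
  have hdiff : gaussianTail 0 - gaussianTail w = ∫ t in (0 : ℝ)..w, Real.exp (-(t ^ 2) / 2) :=
    intervalIntegral.integral_Ioi_sub_Ioi'
      integrable_exp_neg_sq_div_two.integrableOn integrable_exp_neg_sq_div_two.integrableOn
  have hzero := gaussianTail_add_gaussianTail_neg 0
  rw [neg_zero] at hzero
  have hsq : √(2 * π) ^ 2 = 2 * π := Real.sq_sqrt (by positivity)
  have hid := sq_integral_exp_neg_sq_div_two_add w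
  have hle : ∫ s in (0 : ℝ)..1, Real.exp (-(w ^ 2) * (1 + s ^ 2) / 2) / (1 + s ^ 2) ≤
      Real.exp (-(w ^ 2) / 2) * (π / 4) := by
    have hpi : ∫ s in (0 : ℝ)..1, 1 / (1 + s ^ 2) = π / 4 := by simp
    rw [← hpi, ← intervalIntegral.integral_const_mul]
    have hpos : ∀ s : ℝ, 1 + s ^ 2 ≠ 0 := fun s => by positivity
    refine intervalIntegral.integral_mono_on zero_le_one
      (Continuous.intervalIntegrable (by fun_prop (disch := exact hpos _)) _ _)
      (Continuous.intervalIntegrable (by fun_prop (disch := exact hpos _)) _ _) fun s _ => ?_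
    rw [mul_one_div]
    gcongr
    nlinarith [mul_nonneg (sq_nonneg w) (sq_nonneg s)]
  rw [← hdiff] at hid
  have hprod : gaussianTail w * gaussianTail (-w) =
      π / 2 - (gaussianTail 0 - gaussianTail w) ^ 2 := by
    rw [show gaussianTail (-w) = √(2 * π) - gaussianTail w by linarith,
      show gaussianTail 0 = √(2 * π) / 2 by linarith]
    linear_combination hsq / 4
  linarith

lemma gaussianReal_Iic_toReal (x : ℝ) :
    ((gaussianReal 0 1) (Set.Iic x)).toReal = gaussianTail (-x) / √(2 * π) := by
  rw [gaussianReal_apply_eq_integral 0 one_ne_zero,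
    ENNReal.toReal_ofReal (integral_nonneg fun _ => gaussianPDFReal_nonneg _ _ _),
    ← setIntegral_Iic_eq_gaussianTail_neg, div_eq_inv_mul, ← integral_const_mul]
  simp [gaussianPDFReal]

/-- The integral in the Stein solution, in terms of the Gaussian tail. -/
lemma setIntegral_exp_mul_indicator_sub (x Φ w : ℝ) :
    ∫ t in Set.Ioi w, Real.exp (-(t ^ 2) / 2) * ((if t ≤ x then (1 : ℝ) else 0) - Φ) =
      gaussianTail w - gaussianTail (max w x) - Φ * gaussianTail w := by
  have hi := integrable_exp_neg_sq_div_two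
  have hint : Integrable ((Set.Ioi x).indicator fun t : ℝ => Real.exp (-(t ^ 2) / 2)) :=
    hi.indicator measurableSet_Ioi
  have hfun : (fun t : ℝ => Real.exp (-(t ^ 2) / 2) * ((if t ≤ x then (1 : ℝ) else 0) - Φ)) =
      fun t => (1 - Φ) * Real.exp (-(t ^ 2) / 2) -
        (Set.Ioi x).indicator (fun t => Real.exp (-(t ^ 2) / 2)) t := by
    funext t
    by_cases h : t ≤ x
    · simp [h, not_lt.mpr h]
      ring
    · simp [h, not_le.mp h]
      ring
  rw [hfun, integral_sub (hi.integrableOn.const_mul _) hint.integrableOn, integral_const_mul,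
    setIntegral_indicator measurableSet_Ioi, Set.Ioi_inter_Ioi]
  change (1 - Φ) * gaussianTail w - gaussianTail (max w x) = _
  ring

/-- Bounds on the Stein solution `e * a * c / S` at `u`, where `S` is the total mass, `a` and `b`
are complementary tails at `u`, `e` is the inverse Gaussian weight, and `c ≤ b` is the tail on the
far side of the jump. -/
lemma tail_product_bounds {S a b c e u : ℝ} (hS : 0 < S) (ha : 0 < a) (hc : 0 < c)
    (he : 0 < e) (hcb : c ≤ b) (hab : a + b = S) (hprod : e * (a * b) ≤ S ^ 2 / 4)
    (hua : u * (e * a) ≤ 1) (hub : -u * (e * b) ≤ 1) :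
    0 < e * a * c / S ∧ e * a * c / S ≤ S / 4 ∧ |u * (e * a * c / S)| ≤ 1 ∧
      |u * (e * a * c / S) - c / S| ≤ 1 := by
  have hb : 0 < b := hc.trans_le hcb
  have hcS : c / S ≤ 1 := by rw [div_le_one hS]; linarith
  have hcS0 : 0 < c / S := by positivity
  have hea : 0 < e * a := by positivity
  have hle : e * a * c ≤ e * a * b := by gcongr
  have key : -u * (e * a * c) ≤ a := by
    rcases le_or_gt 0 u with hu | hu
    · have : 0 ≤ u * (e * a * c) := by positivity
      linarith
    · calc -u * (e * a * c) ≤ -u * (e * a * b) := by gcongr; linarith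
        _ = a * (-u * (e * b)) := by ring
        _ ≤ a := mul_le_of_le_one_right ha.le hub
  have hform : u * (e * a * c / S) = u * (e * a) * (c / S) := by ring
  have hupper : u * (e * a * c / S) ≤ c / S := by
    rw [hform]
    exact mul_le_of_le_one_left hcS0.le hua
  have hlower : -a / S ≤ u * (e * a * c / S) := by
    rw [mul_div_assoc', div_le_div_iff_of_pos_right hS]
    linarith
  have haS : a / S + c / S ≤ 1 := by
    rw [← add_div, div_le_one hS]
    linarith
  have haS0 : 0 < a / S := by positivity
  rw [neg_div] at hlower
  refine ⟨by positivity, ?_, ?_, ?_⟩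
  · rw [div_le_iff₀ hS]
    linarith
  · rw [abs_le]
    constructor <;> linarith
  · rw [abs_le]
    constructor <;> linarith

/-- Bounds for the solution `f_x` of the Stein equation with the indicator test
function `h = 1_{(-∞, x]}`: with `Φ(x) = P(Z ≤ x)` the standard normal cdf,
for all `w` one has `0 < f_x(w) ≤ √(2π)/4`, `|w f_x(w)| ≤ 1`, and the
derivative `f_x'(w) = w f_x(w) + 1_{(-∞,x]}(w) - Φ(x)` satisfies
`|f_x'(w)| ≤ 1`. -/
theorem stein_solution_indicator_bounds
    (x : ℝ)
    (Φ : ℝ) (hΦ : Φ = ((gaussianReal 0 1) (Set.Iic x)).toReal)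
    (f : ℝ → ℝ)
    (hf : ∀ w, f w =
      -(Real.exp (w ^ 2 / 2)) *
        ∫ t in Set.Ioi w, Real.exp (-(t ^ 2) / 2) * ((if t ≤ x then (1 : ℝ) else 0) - Φ)) :
    (∀ w, 0 < f w) ∧ (∀ w, f w ≤ Real.sqrt (2 * Real.pi) / 4) ∧
      (∀ w, |w * f w| ≤ 1) ∧
      (∀ w, |w * f w + ((if w ≤ x then (1 : ℝ) else 0) - Φ)| ≤ 1) := by
  have hS : 0 < √(2 * π) := by positivity
  have hsq : √(2 * π) ^ 2 = 2 * π := Real.sq_sqrt (by positivity)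
  rw [gaussianReal_Iic_toReal] at hΦ
  have hall : ∀ w, 0 < f w ∧ f w ≤ √(2 * π) / 4 ∧ |w * f w| ≤ 1 ∧
      |w * f w + ((if w ≤ x then (1 : ℝ) else 0) - Φ)| ≤ 1 := by
    intro w
    have hx := gaussianTail_add_gaussianTail_neg x
    have hw := gaussianTail_add_gaussianTail_neg w
    have hexp : Real.exp (w ^ 2 / 2) * Real.exp (-(w ^ 2) / 2) = 1 := by
      rw [← Real.exp_add, neg_div, add_neg_cancel, Real.exp_zero]
    have he := Real.exp_pos (w ^ 2 / 2)
    have hprod : Real.exp (w ^ 2 / 2) * (gaussianTail w * gaussianTail (-w)) ≤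
        √(2 * π) ^ 2 / 4 := by
      have h := mul_le_mul_of_nonneg_left (gaussianTail_mul_gaussianTail_neg_le w) he.le
      linear_combination h + π / 2 * hexp - hsq / 4
    have hmills : w * (Real.exp (w ^ 2 / 2) * gaussianTail w) ≤ 1 := by
      have h := mul_le_mul_of_nonneg_left (mul_gaussianTail_le w) he.le
      linear_combination h + hexp
    have hmills' : -w * (Real.exp (w ^ 2 / 2) * gaussianTail (-w)) ≤ 1 := by
      have h := mul_le_mul_of_nonneg_left (mul_gaussianTail_le (-w)) he.le
      rw [neg_sq] at h
      linear_combination h + hexp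
    have hfw := hf w
    rw [setIntegral_exp_mul_indicator_sub] at hfw
    by_cases hwx : w ≤ x
    · rw [max_eq_right hwx] at hfw
      have hΦ' : 1 - Φ = gaussianTail x / √(2 * π) := by
        rw [hΦ, eq_div_iff hS.ne']
        field_simp
        linarith
      have hfw' : f w =
          Real.exp (w ^ 2 / 2) * gaussianTail (-w) * gaussianTail x / √(2 * π) := by
        rw [hfw, show gaussianTail w - gaussianTail x - Φ * gaussianTail w =
          (1 - Φ) * gaussianTail w - gaussianTail x by ring, hΦ',
          show gaussianTail (-w) = √(2 * π) - gaussianTail w by linarith]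
        field_simp
        ring
      obtain ⟨h1, h2, h3, h4⟩ := tail_product_bounds (u := -w) hS (gaussianTail_pos (-w))
        (gaussianTail_pos x) he (gaussianTail_anti hwx) (by linarith)
        (by rwa [mul_comm (gaussianTail (-w))]) hmills' (by rwa [neg_neg])
      rw [← hfw'] at h1 h2 h3 h4
      rw [neg_mul, abs_neg] at h3
      rw [← hΦ', neg_mul, ← neg_add', abs_neg] at h4
      exact ⟨h1, h2, h3, by rwa [if_pos hwx]⟩
    · have hxw := (not_le.mp hwx).le
      rw [max_eq_left hxw] at hfw
      have hfw' : f w =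
          Real.exp (w ^ 2 / 2) * gaussianTail w * gaussianTail (-x) / √(2 * π) := by
        rw [hfw, hΦ]
        ring
      obtain ⟨h1, h2, h3, h4⟩ := tail_product_bounds (u := w) hS (gaussianTail_pos w)
        (gaussianTail_pos (-x)) he (gaussianTail_anti (neg_le_neg hxw)) hw hprod hmills hmills'
      rw [← hfw'] at h1 h2 h3 h4
      rw [← hΦ] at h4
      exact ⟨h1, h2, h3, by rwa [if_neg hwx, zero_sub, ← sub_eq_add_neg]⟩
  exact ⟨fun w => (hall w).1, fun w => (hall w).2.1, fun w => (hall w).2.2.1,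
    fun w => (hall w).2.2.2⟩
end

section
/- Let X be a real-valued random variable with E X = 0, E X² = σ² ∈ (0,∞), and E|X|³ < ∞, and define K(t) = E[X(1{X > t > 0} − 1{X < t < 0})] for t ∈ ℝ. Then K(t) ≥ 0 for all t, ∫_ℝ K(t) dt = σ², and ∫_ℝ |t| K(t) dt = (1/2)E|X|³; in particular σ^{−2}K is a probability density function on ℝ. -/
open MeasureTheory ProbabilityTheory

/-- The integrand `x (1{x > t > 0} - 1{x < t < 0})` of the Stein kernel. -/
noncomputable def steinIntegrand (x t : ℝ) : ℝ :=
  x * ((if x > t ∧ t > 0 then (1 : ℝ) else 0) - (if x < t ∧ t < 0 then (1 : ℝ) else 0))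

lemma steinIntegrand_nonneg (x t : ℝ) : 0 ≤ steinIntegrand x t := by
  unfold steinIntegrand
  split_ifs <;> grind

lemma measurable_steinIntegrand : Measurable (Function.uncurry steinIntegrand) := by
  unfold steinIntegrand Function.uncurry
  refine measurable_fst.mul (Measurable.sub ?_ ?_) <;>
    refine Measurable.ite (MeasurableSet.inter ?_ ?_) measurable_const measurable_const
  · exact measurableSet_lt measurable_snd measurable_fst
  · exact measurableSet_lt measurable_const measurable_snd
  · exact measurableSet_lt measurable_fst measurable_snd
  · exact measurableSet_lt measurable_snd measurable_const

lemma mul_steinIntegrand_of_nonneg {x : ℝ} (hx : 0 ≤ x) (w : ℝ → ℝ) :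
    (fun t => w t * steinIntegrand x t) = (Set.Ioo 0 x).indicator (fun t => x * w t) := by
  ext t
  have h : ¬ (x < t ∧ t < 0) := fun h => by linarith [h.1, h.2]
  simp [steinIntegrand, h, Set.indicator_apply, and_comm, mul_comm]

lemma mul_steinIntegrand_of_nonpos {x : ℝ} (hx : x ≤ 0) (w : ℝ → ℝ) :
    (fun t => w t * steinIntegrand x t) = (Set.Ioo x 0).indicator (fun t => -x * w t) := by
  ext t
  have h : ¬ (t < x ∧ 0 < t) := fun h => by linarith [h.1, h.2]
  by_cases ht : x < t ∧ t < 0 <;>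
    simp [steinIntegrand, h, ht, mul_comm]

lemma integrable_mul_steinIntegrand {w : ℝ → ℝ} (hw : Continuous w) (x : ℝ) :
    Integrable (fun t => w t * steinIntegrand x t) := by
  rcases le_total 0 x with hx | hx
  · rw [mul_steinIntegrand_of_nonneg hx, integrable_indicator_iff measurableSet_Ioo]
    exact ((hw.const_mul x).continuousOn.integrableOn_Icc).mono_set Set.Ioo_subset_Icc_self
  · rw [mul_steinIntegrand_of_nonpos hx, integrable_indicator_iff measurableSet_Ioo]
    exact ((hw.const_mul (-x)).continuousOn.integrableOn_Icc).mono_set Set.Ioo_subset_Icc_self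

lemma integral_mul_steinIntegrand (w : ℝ → ℝ) (x : ℝ) :
    ∫ t, w t * steinIntegrand x t = x * ∫ t in (0 : ℝ)..x, w t := by
  rcases le_total 0 x with hx | hx
  · rw [mul_steinIntegrand_of_nonneg hx, integral_indicator measurableSet_Ioo,
      integral_const_mul, intervalIntegral.integral_of_le hx, integral_Ioc_eq_integral_Ioo]
  · rw [mul_steinIntegrand_of_nonpos hx, integral_indicator measurableSet_Ioo,
      integral_const_mul, intervalIntegral.integral_of_ge hx, integral_Ioc_eq_integral_Ioo]
    ring

/-- Integrating a nonnegative weight `w` against the Stein kernel of `X` gives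
`E[X ∫₀ˣ w]`. -/
lemma integral_mul_integral_steinIntegrand
    {Ω : Type*} [MeasurableSpace Ω] {P : Measure Ω} [SFinite P]
    {X : Ω → ℝ} (hX : Measurable X) {w : ℝ → ℝ} (hw : Continuous w) (hw₀ : ∀ t, 0 ≤ w t)
    (hint : Integrable (fun ω => X ω * ∫ t in (0 : ℝ)..X ω, w t) P) :
    ∫ t, w t * ∫ ω, steinIntegrand (X ω) t ∂P =
      ∫ ω, X ω * (∫ t in (0 : ℝ)..X ω, w t) ∂P := by
  have hmeas : Measurable fun p : Ω × ℝ => w p.2 * steinIntegrand (X p.1) p.2 :=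
    (hw.measurable.comp measurable_snd).mul
      (measurable_steinIntegrand.comp ((hX.comp measurable_fst).prodMk measurable_snd))
  have hprod : Integrable (fun p : Ω × ℝ => w p.2 * steinIntegrand (X p.1) p.2)
      (P.prod volume) := by
    refine (integrable_prod_iff hmeas.aestronglyMeasurable).2
      ⟨.of_forall fun ω => integrable_mul_steinIntegrand hw (X ω), ?_⟩
    simpa only [Real.norm_of_nonneg (mul_nonneg (hw₀ _) (steinIntegrand_nonneg _ _)),
      integral_mul_steinIntegrand] using hint
  simp_rw [← integral_const_mul, ← integral_mul_steinIntegrand]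
  exact (integral_integral_swap hprod).symm

lemma integral_abs_zero_left (x : ℝ) : ∫ t in (0 : ℝ)..x, |t| = x * |x| / 2 := by
  rcases le_total 0 x with hx | hx
  · rw [intervalIntegral.integral_congr (g := fun t => t), integral_id, abs_of_nonneg hx]
    · ring
    · intro t ht
      rw [Set.uIcc_of_le hx] at ht
      exact abs_of_nonneg ht.1
  · rw [intervalIntegral.integral_congr (g := fun t => -t), intervalIntegral.integral_neg,
      integral_id, abs_of_nonpos hx]
    · ring
    · intro t ht
      rw [Set.uIcc_of_ge hx] at ht
      exact abs_of_nonpos ht.2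

/-- For a centered random variable `X` with variance `σ² ∈ (0, ∞)` and finite
third absolute moment, the function
`K(t) = E[X (1{X > t > 0} - 1{X < t < 0})]` is nonnegative, integrates to
`σ²`, and satisfies `∫ |t| K(t) dt = (1/2) E|X|³`; in particular `σ⁻² K` is a
probability density function. -/
theorem stein_kernel_properties
    {Ω : Type*} [MeasurableSpace Ω] (P : Measure Ω) [IsProbabilityMeasure P]
    (X : Ω → ℝ) (hX : Measurable X)
    (hXint : Integrable X P) (hmean : ∫ ω, X ω ∂P = 0)
    (σ : ℝ) (hσ : 0 < σ)
    (hXsq : Integrable (fun ω => (X ω) ^ 2) P)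
    (hvar : ∫ ω, (X ω) ^ 2 ∂P = σ ^ 2)
    (hX3 : Integrable (fun ω => |X ω| ^ 3) P)
    (K : ℝ → ℝ)
    (hK : ∀ t, K t = ∫ ω, X ω *
      ((if X ω > t ∧ t > 0 then (1 : ℝ) else 0) -
        (if X ω < t ∧ t < 0 then (1 : ℝ) else 0)) ∂P) :
    (∀ t, 0 ≤ K t) ∧
      (∫ t, K t ∂(volume : Measure ℝ)) = σ ^ 2 ∧
      (∫ t, |t| * K t ∂(volume : Measure ℝ)) = (1 / 2) * ∫ ω, |X ω| ^ 3 ∂P := by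
  have hK' : K = fun t => ∫ ω, steinIntegrand (X ω) t ∂P := funext hK
  have hcube (x : ℝ) : x * ∫ t in (0 : ℝ)..x, |t| = (1 / 2) * |x| ^ 3 := by
    rw [integral_abs_zero_left, pow_succ, sq_abs]
    ring
  have hsq (x : ℝ) : x * ∫ _ in (0 : ℝ)..x, (1 : ℝ) = x ^ 2 := by
    rw [integral_one]
    ring
  subst hK'
  refine ⟨fun t => integral_nonneg fun ω => steinIntegrand_nonneg _ _, ?_, ?_⟩
  · have h := integral_mul_integral_steinIntegrand (P := P) hX (w := fun _ => 1)
      continuous_const (fun _ => zero_le_one) (by simpa only [hsq] using hXsq)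
    simpa only [one_mul, hsq, hvar] using h
  · have h := integral_mul_integral_steinIntegrand (P := P) hX continuous_abs abs_nonneg
      (by simpa only [hcube] using hX3.const_mul (1 / 2))
    simpa only [hcube, integral_const_mul] using h
end

section
/- Let Z and Z' be independent standard normal random variables, and let ψ: ℝ → ℝ be absolutely continuous with E ψ(Z) = 0, Var(ψ(Z)) = 1, and E[ψ'(Z)²] < ∞. Set W = ψ(Z) and define T(x) = ∫₀¹ (1/(2√t)) E[ψ'(x)·ψ'(√t·x + √(1−t)·Z')] dt. Then for every absolutely continuous f: ℝ → ℝ with bounded a.e. derivative, E[W f(W)] = E[T(Z) f'(W)]. -/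
open MeasureTheory ProbabilityTheory

open Set Filter Topology
open scoped NNReal ENNReal

/-- The points of `ψ ⁻¹' N`, with `N` null, at which `ψ` has a nonzero derivative form a null
set. -/
theorem volume_preimage_inter_hasDerivAt_ne_zero {ψ : ℝ → ℝ} {N : Set ℝ} (hN : volume N = 0) :
    volume {x | ψ x ∈ N ∧ ∃ c, c ≠ 0 ∧ HasDerivAt ψ c x} = 0 := by
  let A : ℕ → Set ℝ := fun n ↦
    {x | ψ x ∈ N ∧ ∀ y, |y - x| < 1 / (n + 1 : ℝ) → |y - x| ≤ (n + 1 : ℝ) * |ψ y - ψ x|}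
  have hsub : {x | ψ x ∈ N ∧ ∃ c, c ≠ 0 ∧ HasDerivAt ψ c x} ⊆ ⋃ n, A n := by
    rintro x ⟨hxN, c, hc, hd⟩
    obtain ⟨K, hK⟩ := (HasDerivAtFilter.isTheta_sub hd hc).isBigO_symm.bound
    rw [prod_pure, eventually_map] at hK
    obtain ⟨ε, hε, hball⟩ := Metric.eventually_nhds_iff.1 hK
    obtain ⟨n₁, hn₁⟩ := exists_nat_one_div_lt hε
    obtain ⟨n₂, hn₂⟩ := exists_nat_ge K
    refine mem_iUnion.2 ⟨max n₁ n₂, hxN, fun y hy ↦ ?_⟩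
    have h1 : (n₁ : ℝ) ≤ (max n₁ n₂ : ℕ) := by exact_mod_cast le_max_left _ _
    have h2 : (n₂ : ℝ) ≤ (max n₁ n₂ : ℕ) := by exact_mod_cast le_max_right _ _
    have hy' : dist y x < ε := by
      rw [Real.dist_eq]
      refine hy.trans (lt_of_le_of_lt ?_ hn₁)
      gcongr
    refine (hball hy').trans ?_
    rw [Real.norm_eq_abs]
    gcongr
    linarith
  refine measure_mono_null hsub (measure_iUnion_null fun n ↦ ?_)
  refine measure_null_of_locally_null _ fun x _ ↦
    ⟨A n ∩ Metric.ball x (1 / (2 * (n + 1 : ℝ))),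
      inter_mem self_mem_nhdsWithin
        (mem_nhdsWithin_of_mem_nhds (Metric.ball_mem_nhds x (by positivity))), ?_⟩
  set u := A n ∩ Metric.ball x (1 / (2 * (n + 1 : ℝ))) with hu
  have hanti : ∀ y ∈ u, ∀ z ∈ u, |y - z| ≤ (n + 1 : ℝ) * |ψ y - ψ z| := by
    rintro y ⟨-, hy⟩ z ⟨hz, hz'⟩
    refine hz.2 y ?_
    have h1 := dist_triangle_right y z x
    rw [Metric.mem_ball] at hy hz'
    rw [← Real.dist_eq]
    refine h1.trans_lt ((add_lt_add hy hz').trans_eq ?_)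
    field_simp
    norm_num
  have hinj : InjOn ψ u := fun y hy z hz h ↦ by
    have := hanti y hy z hz
    rw [h, sub_self, abs_zero, mul_zero] at this
    exact sub_eq_zero.1 (abs_nonpos_iff.1 this)
  have hlip : LipschitzOnWith (n + 1 : ℝ≥0) (Function.invFunOn ψ u) (ψ '' u) := by
    refine LipschitzOnWith.of_dist_le_mul ?_
    rintro _ ⟨y, hy, rfl⟩ _ ⟨z, hz, rfl⟩
    rw [hinj.leftInvOn_invFunOn hy, hinj.leftInvOn_invFunOn hz]
    simpa [Real.dist_eq] using hanti y hy z hz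
  have himg : Function.invFunOn ψ u '' (ψ '' u) = u := hinj.leftInvOn_invFunOn.image_image
  have h0 : volume (ψ '' u) = 0 :=
    measure_mono_null (by rintro _ ⟨y, hy, rfl⟩; exact hy.1.1) hN
  have := hlip.hausdorffMeasure_image_le (d := 1) zero_le_one
  rw [himg, hausdorffMeasure_real, h0, mul_zero] at this
  exact le_antisymm this zero_le

/-- Outside a null set, the chain rule holds for `f ∘ ψ` when `f` is Lipschitz and `f`, `ψ` have
derivatives `f'`, `ψ'` almost everywhere. -/
theorem LipschitzWith.ae_hasDerivAt_comp {f f' ψ ψ' : ℝ → ℝ} {K : ℝ≥0} (hf : LipschitzWith K f)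
    (hf' : ∀ᵐ y, HasDerivAt f (f' y) y) (hψ' : ∀ᵐ x, HasDerivAt ψ (ψ' x) x) :
    ∀ᵐ x, HasDerivAt (f ∘ ψ) (f' (ψ x) * ψ' x) x := by
  have hnull : ∀ᵐ x, ¬ (ψ x ∈ {y | ¬ HasDerivAt f (f' y) y} ∧ ∃ c, c ≠ 0 ∧ HasDerivAt ψ c x) := by
    rw [ae_iff]
    simpa only [not_not] using volume_preimage_inter_hasDerivAt_ne_zero (ψ := ψ) (ae_iff.1 hf')
  filter_upwards [hψ', hnull] with x hx hx'
  by_cases hfx : HasDerivAt f (f' (ψ x)) (ψ x)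
  · exact hfx.comp x hx
  · have h0 : ψ' x = 0 := by
      by_contra h
      exact hx' ⟨hfx, _, h, hx⟩
    rw [h0] at hx ⊢
    rw [mul_zero]
    rw [hasDerivAt_iff_isLittleO] at hx ⊢
    simp only [smul_zero, sub_zero] at hx ⊢
    refine Asymptotics.IsBigO.trans_isLittleO ?_ hx
    refine Asymptotics.IsBigO.of_bound K (Eventually.of_forall fun y ↦ ?_)
    simpa [Real.dist_eq] using hf.dist_le_mul (ψ y) (ψ x)

/-- If `f` is Lipschitz and `ψ` is absolutely continuous, so is `f ∘ ψ`. -/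
theorem LipschitzWith.comp_absolutelyContinuousOnInterval {f ψ : ℝ → ℝ} {K : ℝ≥0} {a b : ℝ}
    (hf : LipschitzWith K f) (hψ : AbsolutelyContinuousOnInterval ψ a b) :
    AbsolutelyContinuousOnInterval (f ∘ ψ) a b := by
  unfold AbsolutelyContinuousOnInterval at hψ ⊢
  refine squeeze_zero (fun _ ↦ Finset.sum_nonneg fun _ _ ↦ dist_nonneg) (fun E ↦ ?_)
    (by simpa using hψ.const_mul (K : ℝ))
  rw [Finset.mul_sum]
  exact Finset.sum_le_sum fun i _ ↦ hf.dist_le_mul _ _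

section Primitive

variable {u u' : ℝ → ℝ}

theorem sub_eq_intervalIntegral_of_le (h : ∀ a b : ℝ, a ≤ b → u b - u a = ∫ t in a..b, u' t)
    (a b : ℝ) : u b - u a = ∫ t in a..b, u' t := by
  rcases le_total a b with hab | hab
  · exact h a b hab
  · rw [intervalIntegral.integral_symm, ← h b a hab, neg_sub]

theorem ae_hasDerivAt_of_sub_eq_intervalIntegral (hu' : LocallyIntegrable u' volume)
    (h : ∀ a b : ℝ, a ≤ b → u b - u a = ∫ t in a..b, u' t) : ∀ᵐ x, HasDerivAt u (u' x) x := by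
  filter_upwards [LocallyIntegrable.ae_hasDerivAt_integral hu'] with x hx
  have : u = fun x ↦ u 0 + ∫ t in (0 : ℝ)..x, u' t := by
    ext y
    rw [← sub_eq_intervalIntegral_of_le h 0 y]
    ring
  rw [this]
  exact (hx 0).const_add _

theorem intervalIntegrable_of_locallyIntegrable (hu' : LocallyIntegrable u' volume) (a b : ℝ) :
    IntervalIntegrable u' volume a b :=
  intervalIntegrable_iff.2 <|
    (hu'.integrableOn_isCompact isCompact_uIcc).mono_set uIoc_subset_uIcc

theorem absolutelyContinuousOnInterval_of_sub_eq_intervalIntegral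
    (hu' : LocallyIntegrable u' volume)
    (h : ∀ a b : ℝ, a ≤ b → u b - u a = ∫ t in a..b, u' t) (a b : ℝ) :
    AbsolutelyContinuousOnInterval u a b := by
  have := (intervalIntegrable_of_locallyIntegrable hu' a
    b).absolutelyContinuousOnInterval_intervalIntegral (c := a) (by simp)
  have hc : AbsolutelyContinuousOnInterval (fun _ : ℝ ↦ u a) a b :=
    (LipschitzWith.const (u a)).lipschitzOnWith.absolutelyContinuousOnInterval
  convert! hc.add this using 1
  ext y
  simp only [Pi.add_apply]
  rw [← sub_eq_intervalIntegral_of_le h a y]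
  ring

theorem continuous_of_sub_eq_intervalIntegral (hu' : LocallyIntegrable u' volume)
    (h : ∀ a b : ℝ, a ≤ b → u b - u a = ∫ t in a..b, u' t) : Continuous u := by
  have : u = fun x ↦ u 0 + ∫ t in (0 : ℝ)..x, u' t := by
    ext y
    rw [← sub_eq_intervalIntegral_of_le h 0 y]
    ring
  rw [this]
  exact continuous_const.add (intervalIntegral.continuous_primitive
    (intervalIntegrable_of_locallyIntegrable hu') 0)

theorem lipschitzWith_of_sub_eq_intervalIntegral {C : ℝ} (hC : ∀ x, |u' x| ≤ C)
    (h : ∀ a b : ℝ, a ≤ b → u b - u a = ∫ t in a..b, u' t) : LipschitzWith C.toNNReal u := by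
  have hC0 : 0 ≤ C := (abs_nonneg _).trans (hC 0)
  refine LipschitzWith.of_dist_le_mul fun x y ↦ ?_
  rw [Real.dist_eq, sub_eq_intervalIntegral_of_le h y x, Real.coe_toNNReal _ hC0, Real.dist_eq]
  rw [← Real.norm_eq_abs (∫ t in y..x, u' t)]
  exact intervalIntegral.norm_integral_le_of_norm_le_const fun t _ ↦ hC t

end Primitive

section Hoeffding

variable {𝕜 : Type*} [RCLike 𝕜]

/-- The set of pairs of points lying in a common interval, indexed by the endpoints. -/
def commonIntervalSet : Set ((ℝ × ℝ) × (ℝ × ℝ)) :=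
  {q | q.2.1 ∈ uIoc q.1.1 q.1.2 ∧ q.2.2 ∈ uIoc q.1.1 q.1.2}

theorem measurableSet_commonIntervalSet : MeasurableSet commonIntervalSet := by
  unfold commonIntervalSet
  simp only [uIoc, mem_Ioc]
  exact ((measurableSet_lt (measurable_fst.fst.min measurable_fst.snd) measurable_snd.fst).inter
    (measurableSet_le measurable_snd.fst (measurable_fst.fst.max measurable_fst.snd))).inter
    ((measurableSet_lt (measurable_fst.fst.min measurable_fst.snd) measurable_snd.snd).inter
    (measurableSet_le measurable_snd.snd (measurable_fst.fst.max measurable_fst.snd)))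

/-- Twice the measure on the plane with the Hoeffding kernel
`γ (Iic (x ⊓ y)) - γ (Iic x) * γ (Iic y)` as its density. -/
noncomputable def hoeffdingMeasure (γ : Measure ℝ) : Measure (ℝ × ℝ) :=
  (((γ.prod γ).prod (volume.prod volume)).restrict commonIntervalSet).map Prod.snd

theorem isFiniteMeasure_hoeffdingMeasure {γ : Measure ℝ} [IsProbabilityMeasure γ]
    (hγ : MemLp id 2 γ) : IsFiniteMeasure (hoeffdingMeasure γ) := by
  refine ⟨?_⟩
  have hsec : ∀ z : ℝ × ℝ, (volume.prod volume : Measure (ℝ × ℝ))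
      (Prod.mk z ⁻¹' commonIntervalSet) = ENNReal.ofReal ((z.2 - z.1) ^ 2) := by
    intro z
    have : Prod.mk z ⁻¹' commonIntervalSet = uIoc z.1 z.2 ×ˢ uIoc z.1 z.2 := rfl
    rw [this, Measure.prod_prod, Real.volume_uIoc, ← ENNReal.ofReal_mul (abs_nonneg _),
      abs_mul_abs_self, sq]
  rw [hoeffdingMeasure, Measure.map_apply measurable_snd MeasurableSet.univ, preimage_univ,
    Measure.restrict_apply_univ, Measure.prod_apply measurableSet_commonIntervalSet]
  simp_rw [hsec]
  have h1 : MemLp (fun z : ℝ × ℝ ↦ z.1) 2 (γ.prod γ) := hγ.comp_fst γ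
  have h2 : MemLp (fun z : ℝ × ℝ ↦ z.2) 2 (γ.prod γ) := hγ.comp_snd γ
  exact (h2.sub h1).integrable_sq.lintegral_lt_top

theorem integral_hoeffdingMeasure_mul {γ : Measure ℝ} [IsProbabilityMeasure γ]
    {u u' v v' : ℝ → 𝕜} (hu : ∀ a b : ℝ, u b - u a = ∫ t in a..b, u' t)
    (hv : ∀ a b : ℝ, v b - v a = ∫ t in a..b, v' t)
    (hint : Integrable (fun p : ℝ × ℝ ↦ u' p.1 * v' p.2) (hoeffdingMeasure γ)) :
    ∫ p, u' p.1 * v' p.2 ∂(hoeffdingMeasure γ) =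
      ∫ z, (u z.2 - u z.1) * (v z.2 - v z.1) ∂(γ.prod γ) := by
  have hS := measurableSet_commonIntervalSet
  have hint' := (integrable_map_measure hint.aestronglyMeasurable
    measurable_snd.aemeasurable).1 hint
  change IntegrableOn _ _ _ at hint'
  rw [← integrable_indicator_iff hS] at hint'
  rw [hoeffdingMeasure, integral_map measurable_snd.aemeasurable hint.aestronglyMeasurable,
    ← integral_indicator hS]
  refine (integral_prod _ hint').trans (integral_congr_ae (Eventually.of_forall fun z ↦ ?_))
  have hI : MeasurableSet (uIoc z.1 z.2) := measurableSet_uIoc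
  have : (fun p : ℝ × ℝ ↦ commonIntervalSet.indicator
      ((fun p : ℝ × ℝ ↦ u' p.1 * v' p.2) ∘ Prod.snd) (z, p)) =
      (uIoc z.1 z.2 ×ˢ uIoc z.1 z.2).indicator fun p : ℝ × ℝ ↦ u' p.1 * v' p.2 := rfl
  change ∫ p : ℝ × ℝ, commonIntervalSet.indicator
      ((fun p : ℝ × ℝ ↦ u' p.1 * v' p.2) ∘ Prod.snd) (z, p) ∂(volume.prod volume) = _
  rw [this, integral_indicator (hI.prod hI), setIntegral_prod_mul]
  simp only [hu, hv, intervalIntegral.intervalIntegral_eq_integral_uIoc]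
  split_ifs <;> simp

theorem integral_prod_sub_mul_sub {γ : Measure ℝ} [IsProbabilityMeasure γ] {u v : ℝ → 𝕜}
    (hu : MemLp u 2 γ) (hv : MemLp v 2 γ) :
    ∫ z, (u z.2 - u z.1) * (v z.2 - v z.1) ∂(γ.prod γ) =
      2 * ∫ x, u x * v x ∂γ - 2 * ((∫ x, u x ∂γ) * ∫ x, v x ∂γ) := by
  have hu1 : Integrable u γ := hu.integrable (by norm_num)
  have hv1 : Integrable v γ := hv.integrable (by norm_num)
  have huv : Integrable (fun x ↦ u x * v x) γ := hu.integrable_mul hv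
  have i1 : Integrable (fun z : ℝ × ℝ ↦ u z.1 * v z.1) (γ.prod γ) := huv.comp_fst γ
  have i2 : Integrable (fun z : ℝ × ℝ ↦ u z.2 * v z.2) (γ.prod γ) := huv.comp_snd γ
  have i3 : Integrable (fun z : ℝ × ℝ ↦ u z.1 * v z.2) (γ.prod γ) := hu1.mul_prod hv1
  have i4 : Integrable (fun z : ℝ × ℝ ↦ v z.1 * u z.2) (γ.prod γ) := hv1.mul_prod hu1
  have i12 : Integrable (fun z : ℝ × ℝ ↦ u z.1 * v z.1 + u z.2 * v z.2) (γ.prod γ) := i1.add i2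
  have i34 : Integrable (fun z : ℝ × ℝ ↦ u z.1 * v z.2 + v z.1 * u z.2) (γ.prod γ) := i3.add i4
  have e : (fun z : ℝ × ℝ ↦ (u z.2 - u z.1) * (v z.2 - v z.1)) = fun z ↦
      (u z.1 * v z.1 + u z.2 * v z.2) - (u z.1 * v z.2 + v z.1 * u z.2) := by
    ext z
    ring
  rw [e, integral_sub i12 i34, integral_add i1 i2, integral_add i3 i4,
    integral_prod_mul, integral_prod_mul, integral_fun_fst (fun x ↦ u x * v x),
    integral_fun_snd (fun x ↦ u x * v x)]
  simp only [probReal_univ, one_smul]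
  ring

end Hoeffding

section Interpolation

/-- The law `dt / (2 √t)` on `(0, 1]`. -/
noncomputable def sqrtLaw : Measure ℝ :=
  (volume.restrict (Ioc (0 : ℝ) 1)).withDensity fun t ↦ ENNReal.ofReal (1 / (2 * √t))

theorem intervalIntegrable_one_div_two_mul_sqrt :
    IntervalIntegrable (fun t : ℝ ↦ 1 / (2 * √t)) volume 0 1 := by
  refine intervalIntegral.intervalIntegrable_deriv_of_nonneg (g := fun t ↦ √t)
    Real.continuous_sqrt.continuousOn (fun t ht ↦ ?_) fun t _ ↦ by positivity
  rw [min_eq_left zero_le_one] at ht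
  exact Real.hasDerivAt_sqrt ht.1.ne'

theorem integral_sqrtLaw {E : Type*} [NormedAddCommGroup E] [NormedSpace ℝ E] (h : ℝ → E) :
    ∫ t, h t ∂sqrtLaw = ∫ t in (0 : ℝ)..1, (1 / (2 * √t)) • h t := by
  rw [sqrtLaw, integral_withDensity_eq_integral_toReal_smul (by fun_prop)
    (Eventually.of_forall fun _ ↦ ENNReal.ofReal_lt_top),
    intervalIntegral.integral_of_le zero_le_one]
  refine integral_congr_ae (Eventually.of_forall fun t ↦ ?_)
  simp only
  rw [ENNReal.toReal_ofReal (by positivity)]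

theorem integral_sqrtLaw_comp_sqrt {E : Type*} [NormedAddCommGroup E] [NormedSpace ℝ E]
    [CompleteSpace E] {h h' : ℝ → E} (hh : ∀ s, HasDerivAt h (h' s) s) (hc : Continuous h') :
    ∫ t, h' √t ∂sqrtLaw = h 1 - h 0 := by
  have hcont : Continuous h := continuous_iff_continuousAt.2 fun s ↦ (hh s).continuousAt
  rw [integral_sqrtLaw]
  convert! intervalIntegral.integral_eq_sub_of_hasDerivAt_of_le (f := fun t ↦ h √t)
    (f' := fun t ↦ (1 / (2 * √t)) • h' √t) zero_le_one
    (hcont.comp Real.continuous_sqrt).continuousOn (fun t ht ↦ ?_) ?_ using 2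
  · simp
  · simp
  · exact (hh √t).scomp t (Real.hasDerivAt_sqrt ht.1.ne')
  · exact intervalIntegrable_one_div_two_mul_sqrt.smul_continuousOn
      (hc.comp Real.continuous_sqrt).continuousOn

instance isProbabilityMeasure_sqrtLaw : IsProbabilityMeasure sqrtLaw := by
  have h := integral_sqrtLaw_comp_sqrt (h := fun s : ℝ ↦ s) (h' := fun _ ↦ 1) hasDerivAt_id'
    continuous_const
  rw [integral_const, smul_eq_mul, mul_one, sub_zero] at h
  refine ⟨?_⟩
  rw [measureReal_def] at h
  exact (ENNReal.toReal_eq_one_iff _).1 h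

/-- The law of `(Z, √t Z + √(1 - t) Z')` where `Z`, `Z'` are standard normal, `t` has law
`dt / (2 √t)` on `(0, 1]`, and the three are independent. -/
noncomputable def interpolationLaw : Measure (ℝ × ℝ) :=
  ((gaussianReal 0 1).prod (sqrtLaw.prod (gaussianReal 0 1))).map
    fun q ↦ (q.1, √q.2.1 * q.1 + √(1 - q.2.1) * q.2.2)

theorem measurable_interpolation : Measurable fun q : ℝ × (ℝ × ℝ) ↦
    (q.1, √q.2.1 * q.1 + √(1 - q.2.1) * q.2.2) := by
  fun_prop

instance isProbabilityMeasure_interpolationLaw : IsProbabilityMeasure interpolationLaw :=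
  Measure.isProbabilityMeasure_map measurable_interpolation.aemeasurable

theorem integral_cexp_gaussianReal (a : ℝ) :
    ∫ x : ℝ, Complex.exp (a * x * Complex.I) ∂(gaussianReal 0 1) =
      Complex.exp (-(a ^ 2 / 2)) := by
  rw [← charFun_apply_real, charFun_gaussianReal]
  simp

theorem integrable_cexp_mul_I {α : Type*} [MeasurableSpace α] {μ : Measure α} [IsFiniteMeasure μ]
    {g : α → ℝ} (hg : Measurable g) : Integrable (fun x ↦ Complex.exp (g x * Complex.I)) μ :=
  (integrable_const (1 : ℝ)).mono' (by fun_prop)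
    (Eventually.of_forall fun x ↦ (Complex.norm_exp_ofReal_mul_I _).le)

theorem integral_cexp_interpolationLaw (a b : ℝ) :
    ∫ p : ℝ × ℝ, Complex.exp ((a * p.1 + b * p.2 : ℝ) * Complex.I) ∂interpolationLaw =
      ∫ t, Complex.exp (-(a ^ 2 + b ^ 2) / 2 - a * b * √t) ∂sqrtLaw := by
  rw [interpolationLaw, integral_map measurable_interpolation.aemeasurable (by fun_prop),
    integral_prod_symm _ (integrable_cexp_mul_I (by fun_prop)), integral_prod]
  swap
  · refine Integrable.integral_prod_right (f := fun q : ℝ × (ℝ × ℝ) ↦ Complex.exp ((a * q.1 +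
      b * (√q.2.1 * q.1 + √(1 - q.2.1) * q.2.2) : ℝ) * Complex.I))
      (integrable_cexp_mul_I (by fun_prop))
  have hsupp : ∀ᵐ t ∂sqrtLaw, t ∈ Ioc (0 : ℝ) 1 :=
    (withDensity_absolutelyContinuous _ _).ae_le (ae_restrict_mem measurableSet_Ioc)
  refine integral_congr_ae ?_
  filter_upwards [hsupp] with t ht
  have e : ∀ z' z : ℝ, Complex.exp ((a * z + b * (√t * z + √(1 - t) * z') : ℝ) * Complex.I) =
      Complex.exp ((b * √(1 - t) : ℝ) * z' * Complex.I) *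
        Complex.exp ((a + b * √t : ℝ) * z * Complex.I) := by
    intro z' z
    rw [← Complex.exp_add]
    push_cast
    ring_nf
  simp only [e]
  simp only [integral_const_mul, integral_mul_const, integral_cexp_gaussianReal]
  rw [← Complex.exp_add]
  congr 1
  have h1 : (√t : ℂ) ^ 2 = t := by
    rw [← Complex.ofReal_pow, Real.sq_sqrt ht.1.le]
  have h2 : (√(1 - t) : ℂ) ^ 2 = 1 - t := by
    rw [← Complex.ofReal_pow, Real.sq_sqrt (by linarith [ht.2])]
    push_cast
    ring
  push_cast
  linear_combination (-(b : ℂ) ^ 2 / 2) * h1 + (-(b : ℂ) ^ 2 / 2) * h2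

theorem map_fst_interpolationLaw : interpolationLaw.map Prod.fst = gaussianReal 0 1 := by
  rw [interpolationLaw, Measure.map_map measurable_fst measurable_interpolation]
  change Measure.map Prod.fst _ = _
  rw [Measure.map_fst_prod]
  simp

theorem map_snd_interpolationLaw : interpolationLaw.map Prod.snd = gaussianReal 0 1 := by
  have : IsProbabilityMeasure (interpolationLaw.map Prod.snd) :=
    Measure.isProbabilityMeasure_map measurable_snd.aemeasurable
  refine Measure.ext_of_charFun (funext fun b ↦ ?_)
  rw [charFun_apply_real, integral_map measurable_snd.aemeasurable (by fun_prop)]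
  have h := integral_cexp_interpolationLaw 0 b
  simp only [zero_mul, zero_add] at h
  push_cast at h
  rw [h, charFun_gaussianReal]
  simp
  ring_nf

/-- The Hoeffding measure of the standard normal law is twice the Gaussian interpolation law. -/
theorem hoeffdingMeasure_gaussianReal :
    hoeffdingMeasure (gaussianReal 0 1) = (2 : ℝ≥0) • interpolationLaw := by
  set γ := gaussianReal 0 1 with hγ
  have : IsFiniteMeasure (hoeffdingMeasure γ) :=
    isFiniteMeasure_hoeffdingMeasure (memLp_id_gaussianReal 2)
  have hcont : ∀ μ : Measure (ℝ × ℝ), IsFiniteMeasure μ → Continuous fun c : ℝ × ℝ ↦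
      ∫ p : ℝ × ℝ, Complex.exp ((c.1 * p.1 + c.2 * p.2 : ℝ) * Complex.I) ∂μ := fun μ _ ↦
    continuous_of_dominated (bound := fun _ ↦ 1) (fun c ↦ by fun_prop)
      (fun c ↦ Eventually.of_forall fun p ↦ (Complex.norm_exp_ofReal_mul_I _).le)
      (integrable_const _) (Eventually.of_forall fun p ↦ by fun_prop)
  have hdense : Dense (({0}ᶜ : Set ℝ) ×ˢ ({0}ᶜ : Set ℝ)) :=
    (dense_compl_singleton 0).prod (dense_compl_singleton 0)
  have key := Continuous.ext_on hdense (hcont (hoeffdingMeasure γ) inferInstance)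
    (hcont ((2 : ℝ≥0) • interpolationLaw) inferInstance) (by
    rintro ⟨a, b⟩ ⟨ha, hb⟩
    replace ha : (a : ℂ) ≠ 0 := by simpa using ha
    replace hb : (b : ℂ) ≠ 0 := by simpa using hb
    have hprim : ∀ c : ℝ, (c : ℂ) ≠ 0 → ∀ s t : ℝ,
        Complex.exp ((c * t : ℝ) * Complex.I) / (c * Complex.I) -
          Complex.exp ((c * s : ℝ) * Complex.I) / (c * Complex.I) =
        ∫ x in s..t, Complex.exp ((c * x : ℝ) * Complex.I) := by
      intro c hc s t
      refine (intervalIntegral.integral_eq_sub_of_hasDerivAt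
        (f := fun x : ℝ ↦ Complex.exp ((c * x : ℝ) * Complex.I) / (c * Complex.I))
        (fun x _ ↦ ?_) (Continuous.intervalIntegrable (by fun_prop) _ _)).symm
      have h1 : HasDerivAt (fun x : ℝ ↦ ((c * x : ℝ) * Complex.I : ℂ)) (c * Complex.I) x := by
        simpa using (((hasDerivAt_id x).const_mul c).ofReal_comp).mul_const Complex.I
      convert! h1.cexp.div_const (c * Complex.I) using 1
      field_simp
    have hL : ∀ c : ℝ, MemLp (fun x : ℝ ↦
        Complex.exp ((c * x : ℝ) * Complex.I) / (c * Complex.I)) 2 γ := fun c ↦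
      MemLp.of_bound (by fun_prop) ‖(c * Complex.I)⁻¹‖ (Eventually.of_forall fun x ↦ by
        rw [norm_div, Complex.norm_exp_ofReal_mul_I, norm_inv, one_div])
    have e : ∀ p : ℝ × ℝ, Complex.exp ((a * p.1 + b * p.2 : ℝ) * Complex.I) =
        Complex.exp ((a * p.1 : ℝ) * Complex.I) * Complex.exp ((b * p.2 : ℝ) * Complex.I) := by
      intro p
      rw [← Complex.exp_add]
      push_cast
      ring_nf
    have hG : ∀ c : ℝ, ∫ x : ℝ, Complex.exp ((c * x : ℝ) * Complex.I) ∂γ =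
        Complex.exp (-(c ^ 2 / 2)) := fun c ↦ by
      simpa using integral_cexp_gaussianReal c
    have hprod : ∀ x : ℝ, Complex.exp ((a * x : ℝ) * Complex.I) / (a * Complex.I) *
        (Complex.exp ((b * x : ℝ) * Complex.I) / (b * Complex.I)) =
        Complex.exp (((a + b : ℝ) * x : ℝ) * Complex.I) / (-(a * b)) := by
      intro x
      rw [div_mul_div_comm, ← Complex.exp_add]
      congr 1
      · push_cast
        ring_nf
      · linear_combination (a * b : ℂ) * Complex.I_sq
    simp only
    rw [integral_smul_nnreal_measure, integral_cexp_interpolationLaw]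
    have hsqrt := integral_sqrtLaw_comp_sqrt
      (h := fun s : ℝ ↦ Complex.exp (-(a ^ 2 + b ^ 2) / 2 - a * b * s) / (-(a * b)))
      (h' := fun s : ℝ ↦ Complex.exp (-(a ^ 2 + b ^ 2) / 2 - a * b * s)) (fun s ↦ by
        have h1 : HasDerivAt (fun x : ℝ ↦ (-(a ^ 2 + b ^ 2) / 2 - a * b * x : ℂ))
            (-(a * b)) s := by
          convert! ((Complex.ofRealCLM.hasDerivAt (x := s)).const_mul (a * b : ℂ)).const_sub
            (-((a : ℂ) ^ 2 + b ^ 2) / 2) using 1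
          simp
        convert! h1.cexp.div_const (-(a * b : ℂ)) using 1
        field_simp) (by fun_prop)
    rw [hsqrt]
    have hint : Integrable (fun p : ℝ × ℝ ↦
        Complex.exp ((a * p.1 + b * p.2 : ℝ) * Complex.I)) (hoeffdingMeasure γ) :=
      integrable_cexp_mul_I (by fun_prop)
    simp only [e] at hint ⊢
    rw [integral_hoeffdingMeasure_mul (hprim a ha) (hprim b hb) hint,
      integral_prod_sub_mul_sub (hL a) (hL b)]
    simp only [hprod]
    rw [integral_div, integral_div, integral_div, hG, hG, hG]
    have h1 : Complex.exp (-(((a + b : ℝ) : ℂ) ^ 2 / 2)) =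
        Complex.exp (-(a ^ 2 + b ^ 2) / 2 - a * b * (1 : ℝ)) := by
      congr 1
      push_cast
      ring
    have h2 : Complex.exp (-((a : ℂ) ^ 2 / 2)) * Complex.exp (-((b : ℂ) ^ 2 / 2)) =
        Complex.exp (-(a ^ 2 + b ^ 2) / 2 - a * b * (0 : ℝ)) := by
      rw [← Complex.exp_add]
      congr 1
      push_cast
      ring
    rw [h1, div_mul_div_comm, h2]
    have h3 : (a * Complex.I * (b * Complex.I) : ℂ) = -(a * b) := by
      linear_combination (a * b : ℂ) * Complex.I_sq
    rw [h3, NNReal.smul_def, Complex.real_smul]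
    push_cast
    ring)
  refine Measure.ext_of_charFunDual (funext fun L ↦ ?_)
  have hLp : ∀ p : ℝ × ℝ, L p = L (1, 0) * p.1 + L (0, 1) * p.2 := by
    intro p
    have : p = p.1 • ((1, 0) : ℝ × ℝ) + p.2 • ((0, 1) : ℝ × ℝ) := by simp
    conv_lhs => rw [this, map_add, map_smul, map_smul]
    simp only [smul_eq_mul]
    ring
  obtain ⟨a, b, hab⟩ : ∃ a b : ℝ, ∀ p, L p = a * p.1 + b * p.2 := ⟨_, _, hLp⟩
  rw [charFunDual_apply, charFunDual_apply]
  simp only [hab]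
  exact congrFun key (a, b)

end Interpolation

section Covariance

theorem measurePreserving_fst_interpolationLaw :
    MeasurePreserving Prod.fst interpolationLaw (gaussianReal 0 1) :=
  ⟨measurable_fst, map_fst_interpolationLaw⟩

theorem measurePreserving_snd_interpolationLaw :
    MeasurePreserving Prod.snd interpolationLaw (gaussianReal 0 1) :=
  ⟨measurable_snd, map_snd_interpolationLaw⟩

theorem integrable_mul_interpolationLaw {u' v' : ℝ → ℝ} (hu' : MemLp u' 2 (gaussianReal 0 1))
    (hv' : MemLp v' 2 (gaussianReal 0 1)) :
    Integrable (fun p : ℝ × ℝ ↦ u' p.1 * v' p.2) interpolationLaw :=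
  (hu'.comp_measurePreserving measurePreserving_fst_interpolationLaw).integrable_mul
    (hv'.comp_measurePreserving measurePreserving_snd_interpolationLaw)

/-- The interpolation formula for the covariance of two functions of a standard normal
variable. -/
theorem integral_mul_interpolationLaw {u u' v v' : ℝ → ℝ}
    (hu : ∀ a b : ℝ, u b - u a = ∫ t in a..b, u' t)
    (hv : ∀ a b : ℝ, v b - v a = ∫ t in a..b, v' t)
    (hu2 : MemLp u 2 (gaussianReal 0 1)) (hv2 : MemLp v 2 (gaussianReal 0 1))
    (hu' : MemLp u' 2 (gaussianReal 0 1)) (hv' : MemLp v' 2 (gaussianReal 0 1)) :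
    ∫ p, u' p.1 * v' p.2 ∂interpolationLaw =
      ∫ x, u x * v x ∂(gaussianReal 0 1) -
        (∫ x, u x ∂(gaussianReal 0 1)) * ∫ x, v x ∂(gaussianReal 0 1) := by
  have hint : Integrable (fun p : ℝ × ℝ ↦ u' p.1 * v' p.2)
      (hoeffdingMeasure (gaussianReal 0 1)) := by
    rw [hoeffdingMeasure_gaussianReal]
    exact (integrable_mul_interpolationLaw hu' hv').smul_measure_nnreal
  have h := integral_hoeffdingMeasure_mul hu hv hint
  rw [integral_prod_sub_mul_sub hu2 hv2, hoeffdingMeasure_gaussianReal,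
    integral_smul_nnreal_measure, NNReal.smul_def, smul_eq_mul, NNReal.coe_ofNat] at h
  linarith

theorem integral_mul_interpolationLaw_eq_integral_mul {u' v' : ℝ → ℝ}
    (hu' : MemLp u' 2 (gaussianReal 0 1)) (hv' : MemLp v' 2 (gaussianReal 0 1)) :
    ∫ p, u' p.1 * v' p.2 ∂interpolationLaw =
      ∫ x, u' x * ∫ q, v' (√q.1 * x + √(1 - q.1) * q.2) ∂(sqrtLaw.prod (gaussianReal 0 1))
        ∂(gaussianReal 0 1) := by
  have hint := integrable_mul_interpolationLaw hu' hv'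
  rw [interpolationLaw, integral_map measurable_interpolation.aemeasurable
    hint.aestronglyMeasurable, integral_prod]
  · simp only [integral_const_mul]
  · exact (integrable_map_measure hint.aestronglyMeasurable
      measurable_interpolation.aemeasurable).1 hint

theorem ae_integral_interpolation_eq {v' : ℝ → ℝ} (hv' : MemLp v' 2 (gaussianReal 0 1)) :
    ∀ᵐ x ∂(gaussianReal 0 1),
      ∫ q, v' (√q.1 * x + √(1 - q.1) * q.2) ∂(sqrtLaw.prod (gaussianReal 0 1)) =
        ∫ t in (0 : ℝ)..1, (1 / (2 * √t)) *
          ∫ z, v' (√t * x + √(1 - t) * z) ∂(gaussianReal 0 1) := by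
  have hint : Integrable (fun p : ℝ × ℝ ↦ v' p.2) interpolationLaw :=
    measurePreserving_snd_interpolationLaw.integrable_comp_of_integrable
      (hv'.integrable (by norm_num))
  have hint' := (integrable_map_measure hint.aestronglyMeasurable
    measurable_interpolation.aemeasurable).1 hint
  filter_upwards [hint'.prod_right_ae] with x hx
  refine (integral_prod _ hx).trans ?_
  rw [integral_sqrtLaw]
  rfl

theorem ae_comp_add_mul_gaussianReal {p : ℝ → Prop} (hp : ∀ᵐ y, p y) (c : ℝ) {d : ℝ}
    (hd : d ≠ 0) : ∀ᵐ z ∂(gaussianReal 0 1), p (c + d * z) := by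
  have hmap : (gaussianReal 0 1).map (fun z ↦ c + d * z) ≪ volume := by
    have : (fun z ↦ c + d * z) = (fun z ↦ c + z) ∘ fun z ↦ d * z := rfl
    rw [this, ← Measure.map_map (by fun_prop) (by fun_prop), gaussianReal_map_const_mul,
      gaussianReal_map_const_add]
    refine gaussianReal_absolutelyContinuous _ ?_
    rw [mul_one, ← NNReal.coe_ne_zero]
    exact pow_ne_zero 2 hd
  exact ae_of_ae_map (by fun_prop) (hmap.ae_le hp)

end Covariance

/-- Chatterjee's Stein identity by Gaussian interpolation: let `Z, Z'` be
independent standard normals and `ψ` absolutely continuous with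
`E ψ(Z) = 0`, `Var(ψ(Z)) = 1`, `E[ψ'(Z)²] < ∞`.  With `W = ψ(Z)` and
`T(x) = ∫₀¹ (1/(2√t)) E[ψ'(x) ψ'(√t x + √(1-t) Z')] dt`, one has
`E[W f(W)] = E[T(Z) f'(W)]` for every absolutely continuous `f` with bounded
a.e. derivative. -/
theorem stein_identity_gaussian_interpolation
    {Ω : Type*} [MeasurableSpace Ω] (P : Measure Ω) [IsProbabilityMeasure P]
    (Z Z' : Ω → ℝ) (hZmeas : Measurable Z) (hZ'meas : Measurable Z')
    (hZlaw : Measure.map Z P = gaussianReal 0 1)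
    (hZ'law : Measure.map Z' P = gaussianReal 0 1)
    (hindep : IndepFun Z Z' P)
    (ψ ψ' : ℝ → ℝ)
    (hψ'loc : LocallyIntegrable ψ' volume)
    (hψFTC : ∀ a b : ℝ, a ≤ b → ψ b - ψ a = ∫ t in a..b, ψ' t)
    (hmean : ∫ ω, ψ (Z ω) ∂P = 0)
    (hvar : ∫ ω, (ψ (Z ω)) ^ 2 ∂P = 1)
    (hψ'sq : Integrable (fun ω => (ψ' (Z ω)) ^ 2) P)
    (T : ℝ → ℝ)
    (hT : ∀ x, T x = ∫ t in (0 : ℝ)..1,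
      (1 / (2 * Real.sqrt t)) *
        ∫ ω, ψ' x * ψ' (Real.sqrt t * x + Real.sqrt (1 - t) * Z' ω) ∂P) :
    ∀ (f f' : ℝ → ℝ), LocallyIntegrable f' volume →
      (∀ a b : ℝ, a ≤ b → f b - f a = ∫ t in a..b, f' t) →
      (∃ C, ∀ x, |f' x| ≤ C) →
      ∫ ω, ψ (Z ω) * f (ψ (Z ω)) ∂P = ∫ ω, T (Z ω) * f' (ψ (Z ω)) ∂P := by
  intro f f' hf'loc hfFTC hbdd
  obtain ⟨C, hC⟩ := hbdd
  set γ := gaussianReal 0 1 with hγ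
  have hac : γ ≪ volume := gaussianReal_absolutelyContinuous 0 one_ne_zero
  have hZ : MeasurePreserving Z P γ := ⟨hZmeas, hZlaw⟩
  have hZ' : MeasurePreserving Z' P γ := ⟨hZ'meas, hZ'law⟩
  have hψcont := continuous_of_sub_eq_intervalIntegral hψ'loc hψFTC
  have hfLip := lipschitzWith_of_sub_eq_intervalIntegral hC hfFTC
  have hψd := ae_hasDerivAt_of_sub_eq_intervalIntegral hψ'loc hψFTC
  have hgd := hfLip.ae_hasDerivAt_comp
    (ae_hasDerivAt_of_sub_eq_intervalIntegral hf'loc hfFTC) hψd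
  have hψac := absolutelyContinuousOnInterval_of_sub_eq_intervalIntegral hψ'loc hψFTC
  have hDψ : ∀ᵐ x, deriv ψ x = ψ' x := hψd.mono fun x hx ↦ hx.deriv
  have hDg : ∀ᵐ x, deriv (f ∘ ψ) x = f' (ψ x) * ψ' x := hgd.mono fun x hx ↦ hx.deriv
  have hgcont : Continuous (f ∘ ψ) := hfLip.continuous.comp hψcont
  have hψ2 : MemLp ψ 2 γ := by
    rw [memLp_two_iff_integrable_sq hψcont.aestronglyMeasurable,
      ← hZ.integrable_comp (by fun_prop)]
    by_contra h
    exact zero_ne_one ((integral_undef h).symm.trans hvar)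
  have hg2 : MemLp (f ∘ ψ) 2 γ := by
    have h1 : MemLp (fun x ↦ f (ψ x) - f 0) 2 γ :=
      hψ2.of_le_mul (hgcont.sub continuous_const).aestronglyMeasurable
        (Eventually.of_forall fun x ↦ by simpa [dist_eq_norm] using hfLip.dist_le_mul (ψ x) 0)
    convert! h1.add (memLp_const (f 0)) using 1
    ext x
    simp
  have hψ'2 : MemLp (deriv ψ) 2 γ := by
    rw [memLp_two_iff_integrable_sq (measurable_deriv ψ).aestronglyMeasurable,
      ← hZ.integrable_comp ((measurable_deriv ψ).pow_const 2).aestronglyMeasurable]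
    refine hψ'sq.congr ?_
    filter_upwards [hZ.quasiMeasurePreserving.ae (hac.ae_le hDψ)] with ω hω
    simp [hω]
  have hg'2 : MemLp (deriv (f ∘ ψ)) 2 γ := by
    refine hψ'2.of_le_mul (c := C) (measurable_deriv _).aestronglyMeasurable ?_
    filter_upwards [hac.ae_le hDψ, hac.ae_le hDg] with x h1 h2
    rw [h1, h2, norm_mul]
    exact mul_le_mul_of_nonneg_right (hC _) (norm_nonneg _)
  have hmean' : ∫ x, ψ x ∂γ = 0 := by
    rw [← hmean, ← hZlaw, integral_map hZmeas.aemeasurable hψcont.aestronglyMeasurable]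
  have hcov := integral_mul_interpolationLaw
    (fun a b ↦ ((hfLip.comp_absolutelyContinuousOnInterval (hψac a b)).integral_deriv_eq_sub).symm)
    (fun a b ↦ (hψac a b).integral_deriv_eq_sub.symm) hg2 hψ2 hg'2 hψ'2
  rw [hmean', mul_zero, sub_zero, integral_mul_interpolationLaw_eq_integral_mul hg'2 hψ'2,
    ← hγ] at hcov
  have hmeas : StronglyMeasurable fun x ↦ deriv (f ∘ ψ) x *
      ∫ q, deriv ψ (√q.1 * x + √(1 - q.1) * q.2) ∂(sqrtLaw.prod γ) := by
    refine (measurable_deriv _).stronglyMeasurable.mul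
      (StronglyMeasurable.integral_prod_right (f := fun x (q : ℝ × ℝ) ↦
        deriv ψ (√q.1 * x + √(1 - q.1) * q.2)) ?_)
    exact ((measurable_deriv ψ).comp (by fun_prop :
      Measurable fun r : ℝ × (ℝ × ℝ) ↦ √r.2.1 * r.1 + √(1 - r.2.1) * r.2.2)).stronglyMeasurable
  have hTeq : ∀ᵐ x ∂γ, T x * f' (ψ x) = deriv (f ∘ ψ) x *
      ∫ q, deriv ψ (√q.1 * x + √(1 - q.1) * q.2) ∂(sqrtLaw.prod γ) := by
    filter_upwards [ae_integral_interpolation_eq hψ'2, hac.ae_le hDg] with x hx hgx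
    have hTx : T x = ψ' x * ∫ t in (0 : ℝ)..1, (1 / (2 * √t)) *
        ∫ z, deriv ψ (√t * x + √(1 - t) * z) ∂γ := by
      rw [hT, ← intervalIntegral.integral_const_mul]
      refine intervalIntegral.integral_congr_ae ?_
      filter_upwards [compl_mem_ae_iff.2 (measure_singleton (1 : ℝ))] with t ht1 ht
      rw [uIoc_of_le zero_le_one] at ht
      have hlt : t < 1 := lt_of_le_of_ne ht.2 ht1
      have hd : √(1 - t) ≠ 0 := (Real.sqrt_pos.2 (sub_pos.2 hlt)).ne'
      rw [integral_const_mul, mul_left_comm]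
      congr 2
      have hm : Measurable fun z : ℝ ↦ deriv ψ (√t * x + √(1 - t) * z) :=
        (measurable_deriv ψ).comp (by fun_prop : Measurable fun z : ℝ ↦ √t * x + √(1 - t) * z)
      rw [← hZ'law, integral_map hZ'meas.aemeasurable hm.aestronglyMeasurable]
      refine integral_congr_ae ?_
      filter_upwards [hZ'.quasiMeasurePreserving.ae
        (ae_comp_add_mul_gaussianReal hDψ (√t * x) hd)] with ω hω using hω.symm
    rw [hx, hTx, hgx]
    ring
  calc ∫ ω, ψ (Z ω) * f (ψ (Z ω)) ∂P
      = ∫ x, (f ∘ ψ) x * ψ x ∂γ := by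
        have hm : Continuous fun x ↦ (f ∘ ψ) x * ψ x := hgcont.mul hψcont
        rw [← hZlaw, integral_map hZmeas.aemeasurable hm.aestronglyMeasurable]
        exact integral_congr_ae (Eventually.of_forall fun ω ↦ mul_comm _ _)
    _ = ∫ ω, deriv (f ∘ ψ) (Z ω) *
          ∫ q, deriv ψ (√q.1 * Z ω + √(1 - q.1) * q.2) ∂(sqrtLaw.prod γ) ∂P := by
        rw [← hcov, ← integral_map (φ := Z) (f := fun x ↦ deriv (f ∘ ψ) x *
          ∫ q, deriv ψ (√q.1 * x + √(1 - q.1) * q.2) ∂(sqrtLaw.prod γ)) hZmeas.aemeasurable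
          hmeas.aestronglyMeasurable, hZlaw]
    _ = ∫ ω, T (Z ω) * f' (ψ (Z ω)) ∂P := by
        refine integral_congr_ae ?_
        filter_upwards [hZ.quasiMeasurePreserving.ae hTeq] with ω hω using hω.symm
end
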